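/- (Biernacki) There exists a function A : ℕ → ℝ with A(p) > 0 for all p, such that for every integer p ≥ 1, every real R > 0, and every analytic function f(z) = ∑_{k=0}^∞ a_k z^k on the disk D_R = {z : |z| < R} which is p-valent in D_R (for every c ∈ ℂ the equation f(z) = c has at most p solutions in D_R, counted with multiplicity), one has |a_k|·R^k ≤ A(p)·k^{2p-1}·max_{1≤i≤p} |a_i|·R^i for every integer k ≥ p+1. -/

import Mathlib

open MeasureTheory Set Filter Topology
open scoped ENNReal NNReal

/-- `g` takes every value at most `p` times on `S`. -/
def PValentOn (p : ℕ) (g : ℂ → ℂ) (S : Set ℂ) : Prop :=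
  ∀ T : Finset ℂ, (∀ z ∈ T, z ∈ S) → (∀ z ∈ T, ∀ w ∈ T, g z = g w) → T.card ≤ p

theorem PValentOn.mono {p : ℕ} {g : ℂ → ℂ} {S S' : Set ℂ} (h : PValentOn p g S) (hS : S' ⊆ S) :
    PValentOn p g S' := fun T hT => h T fun z hz => hS (hT z hz)

theorem PValentOn.comp_injOn {p : ℕ} {g φ : ℂ → ℂ} {S S' : Set ℂ} (h : PValentOn p g S)
    (hφ : MapsTo φ S' S) (hinj : InjOn φ S') : PValentOn p (g ∘ φ) S' := by
  classical
  intro T hT hg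
  have hcard : (T.image φ).card = T.card :=
    Finset.card_image_of_injOn fun x hx y hy => hinj (hT x hx) (hT y hy)
  rw [← hcard]
  refine h _ ?_ ?_
  · simp only [Finset.mem_image]
    rintro _ ⟨z, hz, rfl⟩
    exact hφ (hT z hz)
  · simp only [Finset.mem_image]
    rintro _ ⟨z, hz, rfl⟩ _ ⟨w, hw, rfl⟩
    exact hg z hz w hw

theorem PValentOn.sub_const {p : ℕ} {g : ℂ → ℂ} {S : Set ℂ} (h : PValentOn p g S) (c : ℂ) :
    PValentOn p (fun z => g z - c) S :=
  fun T hT hg => h T hT fun z hz w hw => sub_left_injective (hg z hz w hw)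

theorem abs_det_restrictScalars_toSpanSingleton (a : ℂ) :
    ENNReal.ofReal |((ContinuousLinearMap.toSpanSingleton ℂ a).restrictScalars ℝ).det| =
      ‖a‖ₑ ^ 2 := by
  have h : ((ContinuousLinearMap.toSpanSingleton ℂ a).restrictScalars ℝ).det = ‖a‖ ^ 2 := by
    simp [ContinuousLinearMap.det, LinearMap.det_restrictScalars,
      Algebra.norm_complex_eq, Complex.normSq_eq_norm_sq]
  rw [h, abs_of_nonneg (by positivity), ENNReal.ofReal_pow (norm_nonneg _), ofReal_norm]

theorem exists_injOn_nhds_of_deriv_ne_zero {g : ℂ → ℂ} {V : Set ℂ} (hV : IsOpen V)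
    (hg : DifferentiableOn ℂ g V) {z : ℂ} (hz : z ∈ V) (hd : deriv g z ≠ 0) :
    ∃ U, IsOpen U ∧ z ∈ U ∧ InjOn g U := by
  have h1 : HasStrictDerivAt g (deriv g z) z :=
    ((hg.analyticOnNhd hV) z hz).hasStrictDerivAt
  have h2 := h1.hasStrictFDerivAt_equiv hd
  refine ⟨(h2.toOpenPartialHomeomorph g).source, (h2.toOpenPartialHomeomorph g).open_source,
    h2.mem_toOpenPartialHomeomorph_source, (h2.toOpenPartialHomeomorph g).injOn⟩

/-- Change of variables inequality for `p`-valent holomorphic maps. -/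
theorem lintegral_comp_mul_sq_deriv_le {p : ℕ} {g : ℂ → ℂ} {S V : Set ℂ} (hV : IsOpen V)
    (hSV : S ⊆ V) (hS : MeasurableSet S) (hg : DifferentiableOn ℂ g V) (hp : PValentOn p g S)
    (φ : ℂ → ℝ≥0∞) (hφ : Measurable φ) :
    ∫⁻ z in S, φ (g z) * ‖deriv g z‖ₑ ^ 2 ≤ p * ∫⁻ w, φ w := by
  classical
  set S₀ := S ∩ {z | deriv g z ≠ 0} with hS₀
  have hS₀m : MeasurableSet S₀ :=
    hS.inter (measurable_deriv g (measurableSet_singleton (0 : ℂ)).compl)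
  have hinj : ∀ z : ℂ, ∃ U : Set ℂ, IsOpen U ∧ (z ∈ S₀ → z ∈ U ∧ InjOn g U) := by
    intro z
    by_cases hz : z ∈ S₀
    · obtain ⟨U, h1, h2, h3⟩ := exists_injOn_nhds_of_deriv_ne_zero hV hg (hSV hz.1) hz.2
      exact ⟨U, h1, fun _ => ⟨h2, h3⟩⟩
    · exact ⟨∅, isOpen_empty, fun h => absurd h hz⟩
  choose U hUo hU using hinj
  obtain ⟨t, htS, htc, hcov⟩ := TopologicalSpace.countable_cover_nhdsWithin (f := U) (s := S₀)
    fun x hx => mem_nhdsWithin_of_mem_nhds ((hUo x).mem_nhds (hU x hx).1)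
  have hcov' : ∃ W : ℕ → Set ℂ, (∀ n, IsOpen (W n)) ∧ (∀ n, InjOn g (W n)) ∧ S₀ ⊆ ⋃ n, W n := by
    rcases t.eq_empty_or_nonempty with rfl | hne
    · exact ⟨fun _ => ∅, fun _ => isOpen_empty, fun _ => injOn_empty _, by simpa using hcov⟩
    · obtain ⟨e, he⟩ := htc.exists_eq_range hne
      refine ⟨fun n => U (e n), fun n => hUo _, fun n => (hU _ (htS (he ▸ mem_range_self n))).2, ?_⟩
      intro z hz
      obtain ⟨x, hx, hzx⟩ := mem_iUnion₂.1 (hcov hz)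
      rw [he] at hx
      obtain ⟨n, rfl⟩ := hx
      exact mem_iUnion.2 ⟨n, hzx⟩
  obtain ⟨W, hWo, hWi, hWc⟩ := hcov'
  set P : ℕ → Set ℂ := fun n => S₀ ∩ disjointed W n with hP
  have hPm : ∀ n, MeasurableSet (P n) := fun n =>
    hS₀m.inter (MeasurableSet.disjointed (fun n => (hWo n).measurableSet) n)
  have hPi : ∀ n, InjOn g (P n) := fun n => (hWi n).mono fun z hz => disjointed_subset W n hz.2
  have hPd : Pairwise (Function.onFun Disjoint P) := fun i j hij =>
    (disjoint_disjointed W hij).mono inter_subset_right inter_subset_right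
  have hPU : ⋃ n, P n = S₀ := by
    rw [← inter_iUnion, iUnion_disjointed]
    exact inter_eq_left.2 hWc
  have hPS : ∀ n, P n ⊆ S := fun n z hz => hz.1.1
  have hder : ∀ z ∈ S, HasFDerivAt g
      ((ContinuousLinearMap.toSpanSingleton ℂ (deriv g z)).restrictScalars ℝ) z := fun z hz =>
    (hg.differentiableAt (hV.mem_nhds (hSV hz))).hasDerivAt.hasFDerivAt.restrictScalars ℝ
  have hgm : ∀ n, MeasurableSet (g '' P n) := fun n =>
    (hPm n).image_of_continuousOn_injOn
      (hg.continuousOn.mono ((hPS n).trans hSV)) (hPi n)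
  have h0 : ∫⁻ z in S, φ (g z) * ‖deriv g z‖ₑ ^ 2 = ∫⁻ z in S₀, φ (g z) * ‖deriv g z‖ₑ ^ 2 := by
    rw [← lintegral_indicator hS, ← lintegral_indicator hS₀m]
    congr 1
    ext z
    by_cases h : z ∈ S <;> by_cases h' : deriv g z = 0 <;> simp [hS₀, indicator, h, h']
  have h1 : ∀ n, ∫⁻ z in P n, φ (g z) * ‖deriv g z‖ₑ ^ 2 = ∫⁻ w, (g '' P n).indicator φ w := by
    intro n
    rw [lintegral_indicator (hgm n), lintegral_image_eq_lintegral_abs_det_fderiv_mul volume (hPm n)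
      (fun z hz => (hder z (hPS n hz)).hasFDerivWithinAt) (hPi n)]
    simp_rw [abs_det_restrictScalars_toSpanSingleton, mul_comm]
  rw [h0, ← hPU, lintegral_iUnion hPm hPd]
  simp_rw [h1]
  rw [← lintegral_tsum fun n => (hφ.indicator (hgm n)).aemeasurable,
    ← lintegral_const_mul _ hφ]
  refine lintegral_mono fun w => ?_
  have hsum : ∀ I : Finset ℕ, ∑ n ∈ I, (g '' P n).indicator φ w ≤ p * φ w := by
    intro I
    have h2 : ∑ n ∈ I, (g '' P n).indicator φ w =
        ∑ n ∈ I.filter (fun n => w ∈ g '' P n), φ w := by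
      rw [Finset.sum_filter]
      exact Finset.sum_congr rfl fun n _ => by rw [indicator_apply]
    rw [h2, Finset.sum_const, nsmul_eq_mul]
    gcongr
    have hch : ∀ n, ∃ z, w ∈ g '' P n → z ∈ P n ∧ g z = w := by
      intro n
      by_cases h : w ∈ g '' P n
      · obtain ⟨z, hz⟩ := h
        exact ⟨z, fun _ => hz⟩
      · exact ⟨0, fun h' => absurd h' h⟩
    choose x hx using hch
    have hxinj : InjOn x (I.filter (fun n => w ∈ g '' P n) : Finset ℕ) := by
      intro i hi j hj hij
      by_contra hne
      have hi' := (hx i (Finset.mem_filter.1 hi).2).1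
      have hj' := (hx j (Finset.mem_filter.1 hj).2).1
      exact (hPd hne).le_bot ⟨hi', hij ▸ hj'⟩
    rw [← Finset.card_image_of_injOn hxinj]
    refine hp _ ?_ ?_
    · intro z hz
      obtain ⟨n, hn, rfl⟩ := Finset.mem_image.1 hz
      exact hPS n (hx n (Finset.mem_filter.1 hn).2).1
    · intro z hz z' hz'
      obtain ⟨n, hn, rfl⟩ := Finset.mem_image.1 hz
      obtain ⟨m, hm, rfl⟩ := Finset.mem_image.1 hz'
      rw [(hx n (Finset.mem_filter.1 hn).2).2, (hx m (Finset.mem_filter.1 hm).2).2]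
  rw [ENNReal.tsum_eq_iSup_sum]
  exact iSup_le hsum

theorem sq_lintegral_mul_le {α : Type*} [MeasurableSpace α] (μ : Measure α) {f g : α → ℝ≥0∞}
    (hf : AEMeasurable f μ) (hg : AEMeasurable g μ) :
    (∫⁻ a, f a * g a ∂μ) ^ 2 ≤ (∫⁻ a, f a ^ 2 ∂μ) * ∫⁻ a, g a ^ 2 ∂μ := by
  have h := ENNReal.lintegral_mul_le_Lp_mul_Lq μ Real.HolderConjugate.two_two hf hg
  simp only [ENNReal.rpow_two, Pi.mul_apply] at h
  calc _ ≤ ((∫⁻ a, f a ^ 2 ∂μ) ^ (1 / 2 : ℝ) * (∫⁻ a, g a ^ 2 ∂μ) ^ (1 / 2 : ℝ)) ^ 2 := by gcongr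
    _ = _ := by
      rw [mul_pow, ← ENNReal.rpow_two, ← ENNReal.rpow_two, ← ENNReal.rpow_mul, ← ENNReal.rpow_mul]
      norm_num

/-- Integration of a radial function in polar coordinates. -/
theorem lintegral_comp_norm (F : ℝ → ℝ≥0∞) (hF : Measurable F) :
    ∫⁻ w : ℂ, F ‖w‖ = ENNReal.ofReal (2 * Real.pi) *
      ∫⁻ r in Ioi (0 : ℝ), ENNReal.ofReal r * F r := by
  rw [← Complex.lintegral_comp_polarCoord_symm]
  simp only [Complex.norm_polarCoord_symm, polarCoord_target, smul_eq_mul]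
  rw [Measure.volume_eq_prod, ← Measure.prod_restrict,
    lintegral_prod _ (by fun_prop)]
  simp only [lintegral_const, MeasurableSet.univ, Measure.restrict_apply, univ_inter,
    Real.volume_Ioo]
  rw [lintegral_mul_const _ (by fun_prop), mul_comm]
  congr 1
  · congr 1; ring
  · refine setLIntegral_congr_fun measurableSet_Ioi fun r hr => ?_
    simp only [abs_of_pos (show (0 : ℝ) < r from hr)]

/-- The density of the truncated logarithmic metric `|dw| / |w|` on `r₁ < |w| < r₂`. -/
noncomputable def logDensity (r₁ r₂ : ℝ) (w : ℂ) : ℝ≥0∞ :=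
  {w : ℂ | r₁ < ‖w‖ ∧ ‖w‖ < r₂}.indicator (fun w => ENNReal.ofReal ‖w‖⁻¹) w

theorem measurable_logDensity (r₁ r₂ : ℝ) : Measurable (logDensity r₁ r₂) := by
  refine Measurable.indicator (by fun_prop) ?_
  exact (measurableSet_lt measurable_const measurable_norm).inter
    (measurableSet_lt measurable_norm measurable_const)

theorem lintegral_sq_logDensity_le {r₁ r₂ : ℝ} (h₁ : 0 < r₁) (h₂ : r₁ ≤ r₂) :
    ∫⁻ w, logDensity r₁ r₂ w ^ 2 ≤ ENNReal.ofReal (2 * Real.pi * Real.log (r₂ / r₁)) := by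
  have h0 : ∀ w, logDensity r₁ r₂ w ^ 2 =
      (fun r : ℝ => (Ioo r₁ r₂).indicator (fun r => ENNReal.ofReal r⁻¹ ^ 2) r) ‖w‖ := by
    intro w
    by_cases h : r₁ < ‖w‖ ∧ ‖w‖ < r₂ <;> simp [logDensity, indicator, h]
  simp_rw [h0]
  rw [lintegral_comp_norm _ (Measurable.indicator (by fun_prop) measurableSet_Ioo),
    ENNReal.ofReal_mul (p := 2 * Real.pi) (by positivity)]
  gcongr
  have h3 : ∀ r ∈ Ioi (0 : ℝ), ENNReal.ofReal r *
      (Ioo r₁ r₂).indicator (fun r => ENNReal.ofReal r⁻¹ ^ 2) r =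
      (Ioo r₁ r₂).indicator (fun r => ENNReal.ofReal r⁻¹) r := by
    intro r hr
    have hr : 0 < r := hr
    by_cases h : r ∈ Ioo r₁ r₂
    · simp only [indicator_of_mem h]
      rw [← ENNReal.ofReal_pow (by positivity), ← ENNReal.ofReal_mul hr.le]
      congr 1
      field_simp
    · simp [indicator_of_notMem h]
  rw [setLIntegral_congr_fun measurableSet_Ioi h3]
  calc _ ≤ ∫⁻ r, (Ioo r₁ r₂).indicator (fun r => ENNReal.ofReal r⁻¹) r :=
        setLIntegral_le_lintegral _ _
    _ = ∫⁻ r in Ioo r₁ r₂, ENNReal.ofReal r⁻¹ := lintegral_indicator measurableSet_Ioo _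
    _ = ∫⁻ r in Ioc r₁ r₂, ENNReal.ofReal r⁻¹ := setLIntegral_congr Ioo_ae_eq_Ioc
    _ = ENNReal.ofReal (∫ r in Ioc r₁ r₂, r⁻¹) := by
      rw [ofReal_integral_eq_lintegral_ofReal]
      · have : IntervalIntegrable (fun r : ℝ => r⁻¹) volume r₁ r₂ := by
          refine intervalIntegral.intervalIntegrable_inv (fun r hr => ?_) continuousOn_id
          rw [uIcc_of_le h₂] at hr
          exact (h₁.trans_le hr.1).ne'
        exact (intervalIntegrable_iff_integrableOn_Ioc_of_le h₂).1 this
      · filter_upwards [ae_restrict_mem measurableSet_Ioc] with r hr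
        exact inv_nonneg.2 (h₁.trans hr.1).le
    _ ≤ ENNReal.ofReal (Real.log (r₂ / r₁)) := by
      rw [← intervalIntegral.integral_of_le h₂, integral_inv_of_pos h₁ (h₁.trans_le h₂)]

/-- `∫_{|w| ≤ T} dA / (1 + |w|) ≤ 2πT`. -/
theorem lintegral_indicator_inv_one_add_norm_le (T : ℝ) :
    ∫⁻ w : ℂ, {w : ℂ | ‖w‖ ≤ T}.indicator (fun w => ENNReal.ofReal (1 + ‖w‖)⁻¹) w ≤
      ENNReal.ofReal (2 * Real.pi * T) := by
  have h0 : ∀ w : ℂ, {w : ℂ | ‖w‖ ≤ T}.indicator (fun w => ENNReal.ofReal (1 + ‖w‖)⁻¹) w =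
      (fun r : ℝ => (Iic T).indicator (fun r => ENNReal.ofReal (1 + r)⁻¹) r) ‖w‖ := by
    intro w
    by_cases h : ‖w‖ ≤ T <;> simp [indicator, h]
  simp_rw [h0]
  rw [lintegral_comp_norm _ (Measurable.indicator (by fun_prop) measurableSet_Iic),
    ENNReal.ofReal_mul (p := 2 * Real.pi) (by positivity)]
  gcongr
  calc _ ≤ ∫⁻ r in Ioi (0 : ℝ), (Iic T).indicator (fun _ => 1) r := by
        refine setLIntegral_mono' measurableSet_Ioi fun r hr => ?_
        have hr : 0 < r := hr
        by_cases h : r ∈ Iic T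
        · simp only [indicator_of_mem h]
          rw [← ENNReal.ofReal_mul hr.le, ENNReal.ofReal_le_one, ← div_eq_mul_inv]
          exact div_le_one_of_le₀ (by linarith) (by positivity)
        · simp [indicator_of_notMem h]
    _ = ENNReal.ofReal T := by
        rw [lintegral_indicator measurableSet_Iic, setLIntegral_one,
          Measure.restrict_apply measurableSet_Iic, inter_comm, Ioi_inter_Iic, Real.volume_Ioc]
        simp

theorem ofReal_log_sub_log_le_lintegral {h h' : ℝ → ℂ} {a b r₁ r₂ ρ₁ ρ₂ : ℝ} (hab : a ≤ b)
    (hd : ∀ t ∈ Icc a b, HasDerivAt h (h' t) t) (hc : ContinuousOn h' (Icc a b))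
    (h₁ : 0 < r₁) (hρ₁ : r₁ ≤ ρ₁) (hρ : ρ₁ < ρ₂) (hρ₂ : ρ₂ ≤ r₂)
    (ha : ‖h a‖ ≤ ρ₁) (hb : ρ₂ ≤ ‖h b‖) :
    ENNReal.ofReal (Real.log ρ₂ - Real.log ρ₁) ≤
      ∫⁻ t in Ioc a b, logDensity r₁ r₂ (h t) * ‖h' t‖ₑ := by
  have hcont : ContinuousOn h (Icc a b) := fun t ht => (hd t ht).continuousAt.continuousWithinAt
  have hρ0 : 0 < ρ₁ := h₁.trans_le hρ₁
  obtain ⟨t₂, ⟨ht₂, ht₂'⟩, hleast⟩ : ∃ t, IsLeast (Icc a b ∩ {t | ρ₂ ≤ ‖h t‖}) t := by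
    refine IsCompact.exists_isLeast ?_ ⟨b, right_mem_Icc.2 hab, hb⟩
    exact isCompact_Icc.of_isClosed_subset
      (hcont.norm.preimage_isClosed_of_isClosed isClosed_Icc isClosed_Ici) inter_subset_left
  have hsub : Icc a t₂ ⊆ Icc a b := Icc_subset_Icc_right ht₂.2
  obtain ⟨t₁, ⟨ht₁, ht₁'⟩, hgreat⟩ : ∃ t, IsGreatest (Icc a t₂ ∩ {t | ‖h t‖ ≤ ρ₁}) t := by
    refine IsCompact.exists_isGreatest ?_ ⟨a, left_mem_Icc.2 ht₂.1, ha⟩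
    exact isCompact_Icc.of_isClosed_subset
      ((hcont.mono hsub).norm.preimage_isClosed_of_isClosed isClosed_Icc isClosed_Iic)
      inter_subset_left
  simp only [mem_ofPred_eq] at ht₁' ht₂'
  have h12 : t₁ ≤ t₂ := ht₁.2
  have hsub' : Icc t₁ t₂ ⊆ Icc a b := Icc_subset_Icc ht₁.1 ht₂.2
  have hlow : ∀ t ∈ Ioc t₁ t₂, ρ₁ < ‖h t‖ := by
    intro t ht
    by_contra hcon
    exact absurd (hgreat ⟨⟨ht₁.1.trans ht.1.le, ht.2⟩, not_lt.1 hcon⟩) (not_le.2 ht.1)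
  have hhigh : ∀ t ∈ Ico t₁ t₂, ‖h t‖ < ρ₂ := by
    intro t ht
    by_contra hcon
    exact absurd (hleast ⟨hsub' ⟨ht.1, ht.2.le⟩, not_lt.1 hcon⟩) (not_le.2 ht.2)
  have heq : ‖h t₁‖ = ρ₁ := by
    obtain ⟨t, ht, hte⟩ := intermediate_value_Icc h12 (hcont.norm.mono hsub')
      ⟨ht₁', hρ.le.trans ht₂'⟩
    have hte : ‖h t‖ = ρ₁ := hte
    have : t ≤ t₁ := hgreat ⟨⟨ht₁.1.trans ht.1, ht.2⟩, hte.le⟩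
    rwa [le_antisymm this ht.1] at hte
  have hpos : ∀ t ∈ Icc t₁ t₂, 0 < ‖h t‖ := by
    intro t ht
    rcases ht.1.eq_or_lt with rfl | hlt
    · rw [heq]; exact hρ0
    · exact hρ0.trans (hlow t ⟨hlt, ht.2⟩)
  set d : ℝ → ℝ := fun t => 2 * inner ℝ (h t) (h' t) / ‖h t‖ ^ 2 / 2 with hdef
  have hder : ∀ t ∈ uIcc t₁ t₂, HasDerivAt (fun t => Real.log (‖h t‖ ^ 2) / 2) (d t) t := by
    intro t ht
    rw [uIcc_of_le h12] at ht
    exact ((hd t (hsub' ht)).norm_sq.log (pow_ne_zero _ (hpos t ht).ne')).div_const 2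
  have hdc : ContinuousOn d (Icc t₁ t₂) := by
    have e1 := hcont.mono hsub'
    have e2 := hc.mono hsub'
    refine ContinuousOn.div_const (ContinuousOn.div ?_ (e1.norm.pow 2)
      fun t ht => pow_ne_zero _ (hpos t ht).ne') 2
    exact continuousOn_const.mul (e1.inner e2)
  have hInt := intervalIntegral.integral_eq_sub_of_hasDerivAt hder
    (hdc.intervalIntegrable_of_Icc h12)
  rw [intervalIntegral.integral_of_le h12] at hInt
  have hlog : ∀ t, Real.log (‖h t‖ ^ 2) / 2 = Real.log ‖h t‖ := fun t => by
    rw [Real.log_pow]; push_cast; ring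
  simp only [hlog] at hInt
  rw [heq] at hInt
  calc ENNReal.ofReal (Real.log ρ₂ - Real.log ρ₁)
      ≤ ENNReal.ofReal (∫ t in Ioc t₁ t₂, d t) := by
        rw [hInt]
        exact ENNReal.ofReal_le_ofReal
          (sub_le_sub_right (Real.log_le_log (hρ0.trans hρ) ht₂') _)
    _ ≤ ∫⁻ t in Ioc t₁ t₂, ‖d t‖ₑ :=
        (Real.ofReal_le_enorm _).trans (enorm_integral_le_lintegral_enorm _)
    _ = ∫⁻ t in Ioo t₁ t₂, ‖d t‖ₑ := setLIntegral_congr Ioo_ae_eq_Ioc.symm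
    _ ≤ ∫⁻ t in Ioo t₁ t₂, logDensity r₁ r₂ (h t) * ‖h' t‖ₑ := by
        refine setLIntegral_mono' measurableSet_Ioo fun t ht => ?_
        have hmem : r₁ < ‖h t‖ ∧ ‖h t‖ < r₂ :=
          ⟨hρ₁.trans_lt (hlow t ⟨ht.1, ht.2.le⟩), (hhigh t ⟨ht.1.le, ht.2⟩).trans_le hρ₂⟩
        have h0 := hpos t ⟨ht.1.le, ht.2.le⟩
        rw [logDensity, indicator_of_mem (show h t ∈ {w : ℂ | r₁ < ‖w‖ ∧ ‖w‖ < r₂} from hmem),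
          ← ofReal_norm, ← ofReal_norm, ← ENNReal.ofReal_mul (by positivity)]
        refine ENNReal.ofReal_le_ofReal ?_
        have hin := abs_real_inner_le_norm (h t) (h' t)
        have : ‖d t‖ = |inner ℝ (h t) (h' t)| / ‖h t‖ ^ 2 := by
          rw [hdef, Real.norm_eq_abs, abs_div, abs_div, abs_mul]
          simp; ring
        rw [this, div_le_iff₀ (by positivity)]
        calc _ ≤ ‖h t‖ * ‖h' t‖ := hin
          _ = _ := by field_simp
    _ ≤ _ := lintegral_mono_set
        (Ioo_subset_Ioc_self.trans (Ioc_subset_Ioc ht₁.1 ht₂.2))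

/-- `log |w|` truncated to the range `[log r₁, log r₂]`. -/
noncomputable def clampLog (r₁ r₂ : ℝ) (w : ℂ) : ℝ := Real.log (max r₁ (min r₂ ‖w‖))

theorem clampLog_of_norm_le {r₁ r₂ : ℝ} {w : ℂ} (h : ‖w‖ ≤ r₁) :
    clampLog r₁ r₂ w = Real.log r₁ := by
  rw [clampLog, max_eq_left ((min_le_right _ _).trans h)]

theorem clampLog_of_le_norm {r₁ r₂ : ℝ} (hr : r₁ ≤ r₂) {w : ℂ} (h : r₂ ≤ ‖w‖) :
    clampLog r₁ r₂ w = Real.log r₂ := by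
  rw [clampLog, min_eq_left h, max_eq_right hr]

theorem ofReal_clampLog_sub_le_lintegral {h h' : ℝ → ℂ} {a b r₁ r₂ : ℝ} (hab : a ≤ b)
    (hd : ∀ t ∈ Icc a b, HasDerivAt h (h' t) t) (hc : ContinuousOn h' (Icc a b))
    (h₁ : 0 < r₁) (h₂ : r₁ ≤ r₂) :
    ENNReal.ofReal (clampLog r₁ r₂ (h b) - clampLog r₁ r₂ (h a)) ≤
      ∫⁻ t in Ioc a b, logDensity r₁ r₂ (h t) * ‖h' t‖ₑ := by
  rcases le_or_gt (max r₁ (min r₂ ‖h b‖)) (max r₁ (min r₂ ‖h a‖)) with hle | hlt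
  · rw [ENNReal.ofReal_of_nonpos]
    · exact zero_le
    · exact sub_nonpos.2 (Real.log_le_log (h₁.trans_le (le_max_left _ _)) hle)
  · refine ofReal_log_sub_log_le_lintegral hab hd hc h₁ (le_max_left _ _) hlt
      (max_le h₂ (min_le_left _ _)) ?_ ?_
    · have : min r₂ ‖h a‖ < r₂ := ((le_max_right _ _).trans_lt hlt).trans_le
        (max_le h₂ (min_le_left _ _))
      have h3 : ‖h a‖ < r₂ := by simpa using this
      rw [min_eq_right h3.le]
      exact le_max_right _ _
    · have : r₁ < min r₂ ‖h b‖ := by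
        have := (le_max_left _ _).trans_lt hlt
        simpa using this
      rw [max_eq_right this.le]
      exact min_le_right _ _

theorem ofReal_abs_clampLog_sub_le_lintegral {h h' : ℝ → ℂ} {a b r₁ r₂ : ℝ} (hab : a ≤ b)
    (hd : ∀ t ∈ Icc a b, HasDerivAt h (h' t) t) (hc : ContinuousOn h' (Icc a b))
    (h₁ : 0 < r₁) (h₂ : r₁ ≤ r₂) :
    ENNReal.ofReal |clampLog r₁ r₂ (h b) - clampLog r₁ r₂ (h a)| ≤
      ∫⁻ t in Ioc a b, logDensity r₁ r₂ (h t) * ‖h' t‖ₑ := by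
  rcases le_total 0 (clampLog r₁ r₂ (h b) - clampLog r₁ r₂ (h a)) with h0 | h0
  · rw [abs_of_nonneg h0]
    exact ofReal_clampLog_sub_le_lintegral hab hd hc h₁ h₂
  · rw [abs_of_nonpos h0, neg_sub]
    have hmap : ∀ t ∈ Icc a b, a + b - t ∈ Icc a b := fun t ht =>
      ⟨by linarith [ht.2], by linarith [ht.1]⟩
    have hd' : ∀ t ∈ Icc a b, HasDerivAt (fun t => h (a + b - t)) (-h' (a + b - t)) t := by
      intro t ht
      have := (hd _ (hmap t ht)).scomp t ((hasDerivAt_id t).const_sub (a + b))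
      simpa [Function.comp_def] using this
    have hc' : ContinuousOn (fun t => -h' (a + b - t)) (Icc a b) :=
      (hc.comp (by fun_prop) hmap).neg
    have key := ofReal_clampLog_sub_le_lintegral hab hd' hc' h₁ h₂
    simp only [add_sub_cancel_left, add_sub_cancel_right, enorm_neg] at key
    refine key.trans (le_of_eq ?_)
    have e : ∀ s : Set ℝ, MeasurableSet s → ∀ F : ℝ → ℝ≥0∞,
        ∫⁻ t in s, F (a + b - t) = ∫⁻ t in (fun t => a + b - t) ⁻¹' s, F t := by
      intro s hs F
      rw [← lintegral_indicator hs, ← lintegral_indicator (hs.preimage (by fun_prop)),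
        ← lintegral_sub_left_eq_self _ (a + b)]
      congr 1
      ext t
      by_cases ht : a + b - t ∈ s <;> simp [indicator, ht]
    rw [e _ measurableSet_Ioc (fun t => logDensity r₁ r₂ (h t) * ‖h' t‖ₑ)]
    rw [setLIntegral_congr (Ioo_ae_eq_Ioc (a := a) (b := b)).symm]
    simp only [preimage_const_sub_Ioc, add_sub_cancel_left, add_sub_cancel_right]
    exact setLIntegral_congr Ioo_ae_eq_Ico.symm

theorem ofReal_three_abs_clampLog_sub_le_lintegral {h h' : ℝ → ℂ} {a b s t r₁ r₂ : ℝ}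
    (has : a ≤ s) (hst : s ≤ t) (htb : t ≤ b)
    (hd : ∀ t ∈ Icc a b, HasDerivAt h (h' t) t) (hc : ContinuousOn h' (Icc a b))
    (h₁ : 0 < r₁) (h₂ : r₁ ≤ r₂) :
    ENNReal.ofReal (|clampLog r₁ r₂ (h s) - clampLog r₁ r₂ (h a)| +
      |clampLog r₁ r₂ (h t) - clampLog r₁ r₂ (h s)| +
      |clampLog r₁ r₂ (h b) - clampLog r₁ r₂ (h t)|) ≤
      ∫⁻ t in Ioc a b, logDensity r₁ r₂ (h t) * ‖h' t‖ₑ := by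
  have key : ∀ x y, a ≤ x → x ≤ y → y ≤ b →
      ENNReal.ofReal |clampLog r₁ r₂ (h y) - clampLog r₁ r₂ (h x)| ≤
      ∫⁻ t in Ioc x y, logDensity r₁ r₂ (h t) * ‖h' t‖ₑ := fun x y hx hxy hy =>
    ofReal_abs_clampLog_sub_le_lintegral hxy (fun t ht => hd t (Icc_subset_Icc hx hy ht))
      (hc.mono (Icc_subset_Icc hx hy)) h₁ h₂
  rw [← Ioc_union_Ioc_eq_Ioc (has.trans hst) htb, ← Ioc_union_Ioc_eq_Ioc has hst,
    lintegral_union measurableSet_Ioc, lintegral_union measurableSet_Ioc,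
    ENNReal.ofReal_add (by positivity) (by positivity),
    ENNReal.ofReal_add (by positivity) (by positivity)]
  · exact add_le_add (add_le_add (key a s le_rfl has (hst.trans htb))
      (key s t has hst htb)) (key t b (has.trans hst) htb le_rfl)
  · exact Ioc_disjoint_Ioc_of_le le_rfl
  · rw [Ioc_union_Ioc_eq_Ioc has hst]
    exact Ioc_disjoint_Ioc_of_le le_rfl

theorem hasFPowerSeriesOnBall_ofScalars_of_hasSum {a : ℕ → ℂ} {F : ℂ → ℂ}
    (hF : ∀ z ∈ Metric.ball (0 : ℂ) 1, HasSum (fun k : ℕ => a k * z ^ k) (F z)) :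
    HasFPowerSeriesOnBall F (FormalMultilinearSeries.ofScalars ℂ a) 0 1 where
  r_le := by
    refine ENNReal.le_of_forall_nnreal_lt fun r hr => ?_
    have hr' : (r : ℝ) < 1 := by exact_mod_cast hr
    refine FormalMultilinearSeries.le_radius_of_tendsto _ (l := 0) ?_
    have := (hF (r : ℝ) (by simpa using hr')).summable.tendsto_atTop_zero.norm
    simpa using this
  r_pos := one_pos
  hasSum := by
    intro y hy
    have hy' : y ∈ Metric.ball (0 : ℂ) 1 := by
      simpa [← ofReal_norm] using hy
    have := hF y hy'
    simpa [FormalMultilinearSeries.ofScalars_apply_eq, mul_comm] using this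

theorem differentiableOn_of_hasSum {a : ℕ → ℂ} {F : ℂ → ℂ}
    (hF : ∀ z ∈ Metric.ball (0 : ℂ) 1, HasSum (fun k : ℕ => a k * z ^ k) (F z)) :
    DifferentiableOn ℂ F (Metric.ball 0 1) := by
  have h := (hasFPowerSeriesOnBall_ofScalars_of_hasSum hF).differentiableOn
  refine h.mono fun z hz => ?_
  simpa [← ofReal_norm] using hz

theorem exists_eq_sum_add_pow_mul {a : ℕ → ℂ} {F : ℂ → ℂ}
    (hF : ∀ z ∈ Metric.ball (0 : ℂ) 1, HasSum (fun k : ℕ => a k * z ^ k) (F z)) (n : ℕ) :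
    ∃ h : ℂ → ℂ, DifferentiableOn ℂ h (Metric.ball 0 1) ∧ ∀ z ∈ Metric.ball (0 : ℂ) 1,
      F z = ∑ i ∈ Finset.range n, a i * z ^ i + z ^ n * h z := by
  have hs : ∀ z ∈ Metric.ball (0 : ℂ) 1, Summable fun k : ℕ => a (k + n) * z ^ k := by
    intro z hz
    rcases eq_or_ne z 0 with rfl | h0
    · refine summable_of_ne_finset_zero (s := {0}) fun k hk => ?_
      have : k ≠ 0 := by simpa using hk
      simp [this]
    · have := ((summable_nat_add_iff n).2 (hF z hz).summable).mul_right (z ^ n)⁻¹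
      refine this.congr fun k => ?_
      rw [pow_add]
      field_simp
  refine ⟨fun z => ∑' k, a (k + n) * z ^ k,
    differentiableOn_of_hasSum fun z hz => (hs z hz).hasSum, fun z hz => ?_⟩
  rw [← (hF z hz).tsum_eq, ← (hF z hz).summable.sum_add_tsum_nat_add n, ← tsum_mul_left]
  congr 1
  refine tsum_congr fun k => ?_
  ring

theorem exists_eq_prod_sub_mul {U : Set ℂ} (hU : IsOpen U) {f : ℂ → ℂ}
    (hf : DifferentiableOn ℂ f U) (T : Finset ℂ) (hT : ∀ w ∈ T, w ∈ U ∧ f w = 0) :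
    ∃ k : ℂ → ℂ, DifferentiableOn ℂ k U ∧ ∀ z ∈ U, f z = (∏ w ∈ T, (z - w)) * k z := by
  classical
  induction T using Finset.induction_on with
  | empty => exact ⟨f, hf, fun z _ => by simp⟩
  | insert w₀ T hw₀ ih =>
    obtain ⟨k, hk, hfk⟩ := ih fun w hw => hT w (Finset.mem_insert_of_mem hw)
    obtain ⟨hw₀U, hfw₀⟩ := hT w₀ (Finset.mem_insert_self _ _)
    have hk0 : k w₀ = 0 := by
      have := hfk w₀ hw₀U
      rw [hfw₀] at this
      refine (mul_eq_zero.1 this.symm).resolve_left (Finset.prod_ne_zero_iff.2 fun w hw => ?_)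
      exact sub_ne_zero.2 fun h => hw₀ (h ▸ hw)
    refine ⟨dslope k w₀, (Complex.differentiableOn_dslope (hU.mem_nhds hw₀U)).2 hk, fun z hz => ?_⟩
    have := sub_smul_dslope k w₀ z
    rw [hk0, sub_zero, smul_eq_mul] at this
    rw [hfk z hz, Finset.prod_insert hw₀, ← this]
    ring

theorem exists_regular_value {F : ℂ → ℂ} {U : Set ℂ} (hU : IsOpen U)
    (hF : DifferentiableOn ℂ F U) {ε : ℝ} (hε : 0 < ε) :
    ∃ c : ℂ, ‖c‖ < ε ∧ ∀ z ∈ U, F z = c → deriv F z ≠ 0 := by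
  have h0 : volume (F '' (U ∩ {z | deriv F z = 0})) = 0 := by
    refine addHaar_image_eq_zero_of_det_fderivWithin_eq_zero volume
      (f' := fun z => (ContinuousLinearMap.toSpanSingleton ℂ (deriv F z)).restrictScalars ℝ)
      (fun z hz => ((hF.differentiableAt
        (hU.mem_nhds hz.1)).hasDerivAt.hasFDerivAt.restrictScalars ℝ).hasFDerivWithinAt)
      fun z hz => ?_
    have h1 := abs_det_restrictScalars_toSpanSingleton (deriv F z)
    have hz2 : deriv F z = 0 := hz.2
    rw [hz2] at h1 ⊢
    simpa using h1
  have hpos := Metric.measure_ball_pos (volume : Measure ℂ) 0 hε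
  obtain ⟨c, hc, hc'⟩ : ∃ c ∈ Metric.ball (0 : ℂ) ε, c ∉ F '' (U ∩ {z | deriv F z = 0}) := by
    by_contra! hcon
    exact hpos.ne' (measure_mono_null hcon h0)
  exact ⟨c, by simpa using hc, fun z hz hzc hd => hc' ⟨z, ⟨hz, hd⟩, hzc⟩⟩

theorem PValentOn.finite {p : ℕ} {g : ℂ → ℂ} {S : Set ℂ} (h : PValentOn p g S) (c : ℂ) :
    {z | z ∈ S ∧ g z = c}.Finite := by
  by_contra hinf
  obtain ⟨T, hT, hcard⟩ := Set.Infinite.exists_subset_card_eq hinf (p + 1)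
  have := h T (fun z hz => (hT hz).1) fun z hz w hw => (hT hz).2.trans (hT hw).2.symm
  omega

/-- A `p`-valent function cannot dominate its Taylor polynomial of degree `p` on a whole circle
around the origin: otherwise it would have at least `p + 1` zeros inside. -/
theorem exists_norm_le_of_norm_eq {p : ℕ} {a : ℕ → ℂ} {F : ℂ → ℂ}
    (hF : ∀ z ∈ Metric.ball (0 : ℂ) 1, HasSum (fun k : ℕ => a k * z ^ k) (F z))
    (hp : PValentOn p F (Metric.ball 0 1)) (ha0 : a 0 = 0)
    (ha : ∀ i, 1 ≤ i → i ≤ p → ‖a i‖ ≤ 1) {ρ : ℝ} (hρ : 0 < ρ) (hρ1 : ρ < 1) :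
    ∃ z : ℂ, ‖z‖ = ρ ∧ ‖F z‖ ≤ p + 1 := by
  classical
  by_contra! hcon
  have hd := differentiableOn_of_hasSum hF
  obtain ⟨c, hc, hreg⟩ := exists_regular_value Metric.isOpen_ball hd (ε := 1 / 2) (by norm_num)
  obtain ⟨h, hh, hFh⟩ := exists_eq_sum_add_pow_mul hF (p + 1)
  set P : ℂ → ℂ := fun z => ∑ i ∈ Finset.range (p + 1), a i * z ^ i with hP
  have hPle : ∀ z : ℂ, ‖z‖ = ρ → ‖P z‖ ≤ p := by
    intro z hz
    rw [hP]
    simp only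
    rw [Finset.sum_range_succ', ha0, zero_mul, add_zero]
    refine (norm_sum_le _ _).trans ?_
    calc ∑ i ∈ Finset.range p, ‖a (i + 1) * z ^ (i + 1)‖ ≤ ∑ i ∈ Finset.range p, (1 : ℝ) := by
          refine Finset.sum_le_sum fun i hi => ?_
          rw [norm_mul, norm_pow, hz]
          exact mul_le_one₀ (ha _ (by omega) (by have := Finset.mem_range.1 hi; omega))
            (by positivity) (pow_le_one₀ hρ.le hρ1.le)
      _ = p := by simp
  have hsub : Metric.closedBall (0 : ℂ) ρ ⊆ Metric.ball 0 1 := Metric.closedBall_subset_ball hρ1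
  have hfin : {z | z ∈ Metric.closedBall (0 : ℂ) ρ ∧ F z = c}.Finite :=
    (hp.mono hsub).finite c
  set T := hfin.toFinset with hT
  have hTmem : ∀ w, w ∈ T ↔ ‖w‖ ≤ ρ ∧ F w = c := by
    intro w; simp [hT]
  have hTb : ∀ w ∈ T, w ∈ Metric.ball (0 : ℂ) 1 := fun w hw =>
    hsub (by simpa using ((hTmem w).1 hw).1)
  have hTcard : T.card ≤ p := hp T hTb fun z hz w hw =>
    ((hTmem z).1 hz).2.trans ((hTmem w).1 hw).2.symm
  obtain ⟨k, hk, hFk⟩ := exists_eq_prod_sub_mul Metric.isOpen_ball (hd.sub_const c) T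
    fun w hw => ⟨hTb w hw, sub_eq_zero.2 ((hTmem w).1 hw).2⟩
  have hk0 : ∀ z, ‖z‖ ≤ ρ → k z ≠ 0 := by
    intro z hz hkz
    have hzb : z ∈ Metric.ball (0 : ℂ) 1 := hsub (by simpa using hz)
    have hFz : F z = c := by
      have := hFk z hzb
      rw [hkz, mul_zero] at this
      exact sub_eq_zero.1 this
    have hzT : z ∈ T := (hTmem z).2 ⟨hz, hFz⟩
    have hkd := (hk.differentiableAt (Metric.isOpen_ball.mem_nhds hzb)).hasDerivAt
    have hQd : HasDerivAt (fun z => ∏ w ∈ T, (z - w))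
        (deriv (fun z => ∏ w ∈ T, (z - w)) z) z :=
      DifferentiableAt.hasDerivAt (by fun_prop)
    have h1 := hQd.mul hkd
    have hQ0 : ∏ w ∈ T, (z - w) = 0 := Finset.prod_eq_zero hzT (sub_self z)
    rw [hkz, hQ0, mul_zero, zero_mul, add_zero] at h1
    have h2 : HasDerivAt (fun z => F z - c) 0 z := by
      refine h1.congr_of_eventuallyEq ?_
      filter_upwards [Metric.isOpen_ball.mem_nhds hzb] with y hy using hFk y hy
    have h3 : HasDerivAt F 0 z := by simpa using h2.add_const c
    exact hreg z hzb hFz h3.deriv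
  set G : ℂ → ℂ := fun z => z ^ (p + 1 - T.card) * h z *
    (∏ w ∈ T, (1 - starRingEnd ℂ w * z / (ρ : ℂ) ^ 2)) / k z with hG
  have hGd : DifferentiableOn ℂ G (Metric.closedBall 0 ρ) := by
    refine DifferentiableOn.div (DifferentiableOn.mul (DifferentiableOn.mul (by fun_prop)
      (hh.mono hsub)) (by fun_prop)) (hk.mono hsub) fun z hz => hk0 z (by simpa using hz)
  have hGre : ∀ z, ‖z‖ = ρ → 0 < (G z).re := by
    intro z hz
    have hz0 : z ≠ 0 := by
      rintro rfl
      simp at hz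
      exact hρ.ne hz
    have hρc : (ρ : ℂ) ≠ 0 := by exact_mod_cast hρ.ne'
    have hzb : z ∈ Metric.ball (0 : ℂ) 1 := by simpa [hz] using hρ1
    have hFc : ‖P z - c‖ < ‖F z - c‖ := by
      have h1 := hcon z hz
      have h2 := norm_sub_norm_le (F z) c
      have h3 := norm_sub_le (P z) c
      have h4 := hPle z hz
      linarith
    have hFc0 : F z - c ≠ 0 := norm_pos_iff.1 ((norm_nonneg _).trans_lt hFc)
    have hQ0 : ∏ w ∈ T, (z - w) ≠ 0 := fun h0 => hFc0 (by rw [hFk z hzb, h0, zero_mul])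
    have hb : ∀ w ∈ T, (z - w) * (1 - starRingEnd ℂ w * z / (ρ : ℂ) ^ 2) =
        z * ((‖z - w‖ ^ 2 / ρ ^ 2 : ℝ) : ℂ) := by
      intro w _
      have e1 : z * starRingEnd ℂ z = (ρ : ℂ) ^ 2 := by
        rw [Complex.mul_conj, Complex.normSq_eq_norm_sq, hz]; push_cast; rfl
      have e2 : ((‖z - w‖ ^ 2 : ℝ) : ℂ) = (z - w) * (starRingEnd ℂ z - starRingEnd ℂ w) := by
        rw [← map_sub, Complex.mul_conj, Complex.normSq_eq_norm_sq]
      rw [Complex.ofReal_div, e2]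
      push_cast
      field_simp
      rw [← e1]
      ring
    have hGz : G z = (F z - P z) / (F z - c) * ((∏ w ∈ T, ‖z - w‖ ^ 2 / ρ ^ 2 : ℝ) : ℂ) := by
      have e1 := Finset.prod_congr rfl hb
      rw [Finset.prod_mul_distrib, Finset.prod_mul_distrib, Finset.prod_const] at e1
      have e2 : F z - P z = z ^ (p + 1 - T.card) * z ^ T.card * h z := by
        rw [← pow_add, Nat.sub_add_cancel (by omega), hFh z hzb]
        simp [hP]
      rw [Complex.ofReal_prod, e2, hFk z hzb, hG]
      have hkz := hk0 z hz.le
      simp only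
      rw [div_mul_eq_mul_div, div_eq_div_iff hkz (mul_ne_zero hQ0 hkz)]
      linear_combination (z ^ (p + 1 - T.card) * h z * k z) * e1
    have hre : 0 < ((F z - P z) / (F z - c)).re := by
      have e : (F z - P z) / (F z - c) = 1 - (P z - c) / (F z - c) := by
        field_simp; ring
      rw [e, Complex.sub_re, Complex.one_re, sub_pos]
      refine (Complex.re_le_norm _).trans_lt ?_
      rw [norm_div, div_lt_one (norm_pos_iff.2 hFc0)]
      exact hFc
    rw [hGz, Complex.re_mul_ofReal]
    refine mul_pos hre (Finset.prod_pos fun w hw => ?_)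
    have : z - w ≠ 0 := Finset.prod_ne_zero_iff.1 hQ0 w hw
    positivity
  have hG0 : G 0 = 0 := by
    have : p + 1 - T.card ≠ 0 := by omega
    simp [hG, this]
  obtain ⟨z, hz, hmax⟩ := Complex.exists_mem_frontier_isMaxOn_norm
    (f := fun z => Complex.exp (-G z)) (U := Metric.ball 0 ρ) Metric.isBounded_ball
    ⟨0, by simpa using hρ⟩ (DifferentiableOn.diffContOnCl (by
      rw [closure_ball _ hρ.ne']
      exact hGd.neg.cexp))
  rw [frontier_ball _ hρ.ne'] at hz
  have h1 := hmax (subset_closure (by simpa using hρ : (0 : ℂ) ∈ Metric.ball 0 ρ))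
  have h2 := hGre z (by simpa using hz)
  simp only [Function.comp_apply, hG0, Complex.norm_exp, mem_ofPred_eq, Complex.neg_re,
    Complex.zero_re, Real.exp_le_exp] at h1
  linarith

theorem lintegral_reProdIm {s t : Set ℝ} (hs : MeasurableSet s) (ht : MeasurableSet t)
    {k : ℂ → ℝ≥0∞} (hk : AEMeasurable k (volume.restrict (s ×ℂ t))) :
    ∫⁻ z in s ×ℂ t, k z = ∫⁻ u in s, ∫⁻ v in t, k (u + v * Complex.I) := by
  have hst : MeasurableSet (s ×ℂ t) :=
    (Complex.measurable_re hs).inter (Complex.measurable_im ht)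
  have h1 : MeasurePreserving Complex.measurableEquivRealProd.symm
      (volume.restrict (s ×ˢ t)) (volume.restrict (s ×ℂ t)) :=
    Complex.volume_preserving_equiv_real_prod.symm.restrict_preimage hst
  rw [← h1.lintegral_comp_emb Complex.measurableEquivRealProd.symm.measurableEmbedding,
    Measure.volume_eq_prod, ← Measure.prod_restrict, lintegral_prod]
  · simp only [Complex.measurableEquivRealProd_symm_apply, Complex.mk_eq_add_mul_I]
  · rw [Measure.prod_restrict]
    exact hk.comp_quasiMeasurePreserving h1.quasiMeasurePreserving

theorem lintegral_reProdIm_symm {s t : Set ℝ} (hs : MeasurableSet s) (ht : MeasurableSet t)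
    {k : ℂ → ℝ≥0∞} (hk : AEMeasurable k (volume.restrict (s ×ℂ t))) :
    ∫⁻ z in s ×ℂ t, k z = ∫⁻ v in t, ∫⁻ u in s, k (u + v * Complex.I) := by
  have hst : MeasurableSet (s ×ℂ t) :=
    (Complex.measurable_re hs).inter (Complex.measurable_im ht)
  have h1 : MeasurePreserving Complex.measurableEquivRealProd.symm
      (volume.restrict (s ×ˢ t)) (volume.restrict (s ×ℂ t)) :=
    Complex.volume_preserving_equiv_real_prod.symm.restrict_preimage hst
  rw [← h1.lintegral_comp_emb Complex.measurableEquivRealProd.symm.measurableEmbedding,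
    Measure.volume_eq_prod, ← Measure.prod_restrict, lintegral_prod_symm]
  · simp only [Complex.measurableEquivRealProd_symm_apply, Complex.mk_eq_add_mul_I]
  · rw [Measure.prod_restrict]
    exact hk.comp_quasiMeasurePreserving h1.quasiMeasurePreserving

theorem measurableSet_reProdIm {s t : Set ℝ} (hs : MeasurableSet s) (ht : MeasurableSet t) :
    MeasurableSet (s ×ℂ t) :=
  (Complex.measurable_re hs).inter (Complex.measurable_im ht)

theorem volume_reProdIm {s t : Set ℝ} (hs : MeasurableSet s) (ht : MeasurableSet t) :
    volume (s ×ℂ t) = volume s * volume t := by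
  rw [← setLIntegral_one, lintegral_reProdIm hs ht aemeasurable_const]
  simp [mul_comm]

theorem aemeasurable_comp_mul_enorm_deriv {g : ℂ → ℂ} {S : Set ℂ} (hS : MeasurableSet S)
    (hg : ContinuousOn g S) {ψ : ℂ → ℝ≥0∞} (hψ : Measurable ψ) :
    AEMeasurable (fun z => ψ (g z) * ‖deriv g z‖ₑ) (volume.restrict S) :=
  (hψ.comp_aemeasurable (hg.aemeasurable hS)).mul (measurable_deriv g).enorm.aemeasurable

theorem sq_lintegral_mul_comp_mul_enorm_deriv_le {p : ℕ} {g : ℂ → ℂ} {S V : Set ℂ}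
    (hV : IsOpen V) (hSV : S ⊆ V) (hS : MeasurableSet S) (hg : DifferentiableOn ℂ g V)
    (hp : PValentOn p g S) {ρ ψ : ℂ → ℝ≥0∞}
    (hρ : AEMeasurable ρ (volume.restrict S)) (hψ : Measurable ψ) :
    (∫⁻ z in S, ρ z * (ψ (g z) * ‖deriv g z‖ₑ)) ^ 2 ≤
      (∫⁻ z in S, ρ z ^ 2) * (p * ∫⁻ w, ψ w ^ 2) := by
  refine (sq_lintegral_mul_le _ hρ
    (aemeasurable_comp_mul_enorm_deriv hS (hg.continuousOn.mono hSV) hψ)).trans ?_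
  gcongr
  have := lintegral_comp_mul_sq_deriv_le hV hSV hS hg hp (fun w => ψ w ^ 2) (hψ.pow_const 2)
  simpa only [mul_pow] using this

theorem hasDerivAt_comp_add_mul_I {g : ℂ → ℂ} {u v : ℝ}
    (hg : DifferentiableAt ℂ g (u + v * Complex.I)) :
    HasDerivAt (fun t : ℝ => g (u + t * Complex.I))
      (deriv g (u + v * Complex.I) * Complex.I) v := by
  have h1 : HasDerivAt (fun t : ℂ => g (u + t * Complex.I))
      (deriv g (u + v * Complex.I) * Complex.I) (v : ℂ) := by
    have h2 : HasDerivAt (fun t : ℂ => (u : ℂ) + t * Complex.I) Complex.I (v : ℂ) := by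
      simpa using ((hasDerivAt_id (v : ℂ)).mul_const Complex.I).const_add (u : ℂ)
    exact hg.hasDerivAt.comp (v : ℂ) h2
  exact h1.comp_ofReal

theorem hasDerivAt_comp_ofReal_add {g : ℂ → ℂ} {u v : ℝ}
    (hg : DifferentiableAt ℂ g (u + v * Complex.I)) :
    HasDerivAt (fun t : ℝ => g (t + v * Complex.I)) (deriv g (u + v * Complex.I)) u := by
  have h1 : HasDerivAt (fun t : ℂ => g (t + v * Complex.I))
      (deriv g (u + v * Complex.I)) (u : ℂ) := by
    have h2 : HasDerivAt (fun t : ℂ => t + v * Complex.I) 1 (u : ℂ) := by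
      simpa using (hasDerivAt_id (u : ℂ)).add_const ((v : ℂ) * Complex.I)
    have h3 := hg.hasDerivAt.comp (u : ℂ) h2
    rwa [mul_one] at h3
  exact h1.comp_ofReal

/-- Variation of `clampLog` along a vertical segment. -/
theorem ofReal_three_abs_clampLog_vertical_le {g : ℂ → ℂ} {V : Set ℂ} (hV : IsOpen V)
    (hg : DifferentiableOn ℂ g V) {u a b s t r₁ r₂ : ℝ} (has : a ≤ s) (hst : s ≤ t)
    (htb : t ≤ b) (hsub : ∀ v ∈ Icc a b, (u + v * Complex.I : ℂ) ∈ V)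
    (h₁ : 0 < r₁) (h₂ : r₁ ≤ r₂) :
    ENNReal.ofReal
      (|clampLog r₁ r₂ (g (u + s * Complex.I)) - clampLog r₁ r₂ (g (u + a * Complex.I))| +
      |clampLog r₁ r₂ (g (u + t * Complex.I)) - clampLog r₁ r₂ (g (u + s * Complex.I))| +
      |clampLog r₁ r₂ (g (u + b * Complex.I)) - clampLog r₁ r₂ (g (u + t * Complex.I))|) ≤
      ∫⁻ v in Ioc a b, logDensity r₁ r₂ (g (u + v * Complex.I)) *
        ‖deriv g (u + v * Complex.I)‖ₑ := by
  have h := ofReal_three_abs_clampLog_sub_le_lintegral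
    (h := fun t : ℝ => g (u + t * Complex.I))
    (h' := fun t : ℝ => deriv g (u + t * Complex.I) * Complex.I) has hst htb
    (fun v hv => hasDerivAt_comp_add_mul_I ((hg _ (hsub v hv)).differentiableAt
      (hV.mem_nhds (hsub v hv)))) ?_ h₁ h₂
  · simpa [enorm_mul, ← ofReal_norm] using h
  · exact ((hg.deriv hV).continuousOn.comp (by fun_prop) hsub).mul continuousOn_const

/-- Variation of `clampLog` along a horizontal segment. -/
theorem ofReal_three_abs_clampLog_horizontal_le {g : ℂ → ℂ} {V : Set ℂ} (hV : IsOpen V)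
    (hg : DifferentiableOn ℂ g V) {v a b s t r₁ r₂ : ℝ} (has : a ≤ s) (hst : s ≤ t)
    (htb : t ≤ b) (hsub : ∀ u ∈ Icc a b, (u + v * Complex.I : ℂ) ∈ V)
    (h₁ : 0 < r₁) (h₂ : r₁ ≤ r₂) :
    ENNReal.ofReal
      (|clampLog r₁ r₂ (g (s + v * Complex.I)) - clampLog r₁ r₂ (g (a + v * Complex.I))| +
      |clampLog r₁ r₂ (g (t + v * Complex.I)) - clampLog r₁ r₂ (g (s + v * Complex.I))| +
      |clampLog r₁ r₂ (g (b + v * Complex.I)) - clampLog r₁ r₂ (g (t + v * Complex.I))|) ≤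
      ∫⁻ u in Ioc a b, logDensity r₁ r₂ (g (u + v * Complex.I)) *
        ‖deriv g (u + v * Complex.I)‖ₑ := by
  refine ofReal_three_abs_clampLog_sub_le_lintegral
    (h := fun t : ℝ => g (t + v * Complex.I))
    (h' := fun t : ℝ => deriv g (t + v * Complex.I)) has hst htb
    (fun u hu => hasDerivAt_comp_ofReal_add ((hg _ (hsub u hu)).differentiableAt
      (hV.mem_nhds (hsub u hu)))) ?_ h₁ h₂
  exact (hg.deriv hV).continuousOn.comp (by fun_prop) hsub

theorem exists_norm_eq_norm_le {F : ℂ → ℂ} (hF : DifferentiableOn ℂ F (Metric.ball 0 1))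
    {ρ : ℝ} (hρ : 0 < ρ) (hρ1 : ρ < 1) {z₀ : ℂ} (hz₀ : ‖z₀‖ ≤ ρ) :
    ∃ z : ℂ, ‖z‖ = ρ ∧ ‖F z₀‖ ≤ ‖F z‖ := by
  obtain ⟨z, hz, hmax⟩ := Complex.exists_mem_frontier_isMaxOn_norm
    (f := F) (U := Metric.ball 0 ρ) Metric.isBounded_ball
    ⟨0, by simpa using hρ⟩ (DifferentiableOn.diffContOnCl (by
      rw [closure_ball _ hρ.ne']
      exact hF.mono (Metric.closedBall_subset_ball hρ1)))
  rw [frontier_ball _ hρ.ne'] at hz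
  refine ⟨z, by simpa using hz, hmax ?_⟩
  rw [closure_ball _ hρ.ne']
  simpa using hz₀

theorem differentiableOn_comp_exp {F : ℂ → ℂ} (hF : DifferentiableOn ℂ F (Metric.ball 0 1)) :
    DifferentiableOn ℂ (F ∘ Complex.exp) {z | z.re < 0} := by
  refine hF.comp Complex.differentiable_exp.differentiableOn fun z hz => ?_
  simpa [Complex.norm_exp] using hz

theorem isOpen_re_neg : IsOpen {z : ℂ | z.re < 0} :=
  isOpen_lt Complex.continuous_re continuous_const

theorem reProdIm_subset_re_neg {s t : Set ℝ} (hs : s ⊆ Iio 0) :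
    s ×ℂ t ⊆ {z : ℂ | z.re < 0} := fun _ hz => hs hz.1

theorem PValentOn.comp_exp {p : ℕ} {F : ℂ → ℂ} (hp : PValentOn p F (Metric.ball 0 1))
    {s : Set ℝ} (hs : s ⊆ Iio 0) :
    PValentOn p (F ∘ Complex.exp) (s ×ℂ Ioc (-Real.pi) Real.pi) := by
  refine hp.comp_injOn (fun z hz => ?_) fun z hz w hw h => ?_
  · simpa [Complex.norm_exp] using hs hz.1
  · exact Complex.exp_inj_of_neg_pi_lt_of_le_pi hz.2.1 hz.2.2 hw.2.1 hw.2.2 h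

theorem exists_eq_exp_of_norm_eq {z : ℂ} {u : ℝ} (hz : ‖z‖ = Real.exp u) :
    ∃ v ∈ Ioc (-Real.pi) Real.pi, z = Complex.exp (u + v * Complex.I) := by
  refine ⟨z.arg, Complex.arg_mem_Ioc z, ?_⟩
  rw [Complex.exp_add, ← Complex.ofReal_exp, ← hz, Complex.norm_mul_exp_arg_mul_I]

theorem norm_le_of_norm_le_three_quarters {p : ℕ} {a : ℕ → ℂ} {F : ℂ → ℂ}
    (hF : ∀ z ∈ Metric.ball (0 : ℂ) 1, HasSum (fun k : ℕ => a k * z ^ k) (F z))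
    (hp : PValentOn p F (Metric.ball 0 1)) (ha0 : a 0 = 0)
    (ha : ∀ i, 1 ≤ i → i ≤ p → ‖a i‖ ≤ 1) {z₀ : ℂ} (hz₀ : ‖z₀‖ ≤ 3 / 4) :
    ‖F z₀‖ ≤ (p + 1) * Real.exp (16 * Real.pi ^ 2 * p) := by
  have hd := differentiableOn_of_hasSum hF
  have hr₁ : (0 : ℝ) < p + 1 := by positivity
  rcases le_or_gt ‖F z₀‖ (p + 1) with h | hlt
  · refine h.trans (le_mul_of_one_le_right hr₁.le (Real.one_le_exp (by positivity)))
  set L := Real.log ‖F z₀‖ - Real.log (p + 1) with hL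
  have hLpos : 0 < L := sub_pos.2 (Real.log_lt_log hr₁ hlt)
  have hM : 0 < ‖F z₀‖ := hr₁.trans hlt
  set g := F ∘ Complex.exp with hg
  have hgd := differentiableOn_comp_exp hd
  have hcirc : ∀ u ∈ Ioo (-1 / 4 : ℝ) 0, ENNReal.ofReal L ≤
      ∫⁻ v in Ioc (-Real.pi) Real.pi, logDensity (p + 1) ‖F z₀‖ (g (u + v * Complex.I)) *
        ‖deriv g (u + v * Complex.I)‖ₑ := by
    intro u hu
    have he1 : Real.exp u < 1 := by simpa using hu.2
    obtain ⟨z₁, hz₁, hz₁'⟩ := exists_norm_le_of_norm_eq hF hp ha0 ha (Real.exp_pos u) he1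
    have h34 : 3 / 4 ≤ Real.exp u := by
      have := Real.add_one_le_exp u
      linarith [hu.1]
    obtain ⟨z₂, hz₂, hz₂'⟩ := exists_norm_eq_norm_le hd (Real.exp_pos u) he1 (hz₀.trans h34)
    obtain ⟨v₁, hv₁, e₁⟩ := exists_eq_exp_of_norm_eq hz₁
    obtain ⟨v₂, hv₂, e₂⟩ := exists_eq_exp_of_norm_eq hz₂
    have c₁ : clampLog (p + 1) ‖F z₀‖ (g (u + v₁ * Complex.I)) = Real.log (p + 1) := by
      refine clampLog_of_norm_le ?_
      rw [hg, Function.comp_apply, ← e₁]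
      exact hz₁'
    have c₂ : clampLog (p + 1) ‖F z₀‖ (g (u + v₂ * Complex.I)) = Real.log ‖F z₀‖ := by
      refine clampLog_of_le_norm hlt.le ?_
      rw [hg, Function.comp_apply, ← e₂]
      exact hz₂'
    have hsub : ∀ v ∈ Icc (-Real.pi) Real.pi, (u + v * Complex.I : ℂ) ∈ {z : ℂ | z.re < 0} := by
      intro v _
      simpa using hu.2
    rcases le_total v₁ v₂ with hv | hv
    · refine le_trans (ENNReal.ofReal_le_ofReal ?_) (ofReal_three_abs_clampLog_vertical_le
        isOpen_re_neg hgd hv₁.1.le hv hv₂.2 hsub hr₁ hlt.le)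
      rw [c₁, c₂, ← hL, abs_of_pos hLpos]
      nlinarith [abs_nonneg (Real.log (p + 1) -
        clampLog (p + 1) ‖F z₀‖ (g (u + (-Real.pi : ℝ) * Complex.I))), abs_nonneg (
        clampLog (p + 1) ‖F z₀‖ (g (u + (Real.pi : ℝ) * Complex.I)) - Real.log ‖F z₀‖)]
    · refine le_trans (ENNReal.ofReal_le_ofReal ?_) (ofReal_three_abs_clampLog_vertical_le
        isOpen_re_neg hgd hv₂.1.le hv hv₁.2 hsub hr₁ hlt.le)
      rw [c₁, c₂, abs_sub_comm (Real.log (p + 1)) (Real.log ‖F z₀‖), ← hL, abs_of_pos hLpos]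
      nlinarith [abs_nonneg (Real.log ‖F z₀‖ -
        clampLog (p + 1) ‖F z₀‖ (g (u + (-Real.pi : ℝ) * Complex.I))), abs_nonneg (
        clampLog (p + 1) ‖F z₀‖ (g (u + (Real.pi : ℝ) * Complex.I)) - Real.log (p + 1))]
  set S := Ioo (-1 / 4 : ℝ) 0 ×ℂ Ioc (-Real.pi) Real.pi with hS
  have hneg : Ioo (-1 / 4 : ℝ) 0 ⊆ Iio 0 := fun u hu => hu.2
  have hSm : MeasurableSet S := measurableSet_reProdIm measurableSet_Ioo measurableSet_Ioc
  have hSV : S ⊆ {z : ℂ | z.re < 0} := reProdIm_subset_re_neg hneg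
  have hInt : ENNReal.ofReal (L / 4) ≤
      ∫⁻ z in S, 1 * (logDensity (p + 1) ‖F z₀‖ (g z) * ‖deriv g z‖ₑ) := by
    simp only [one_mul]
    rw [hS, lintegral_reProdIm measurableSet_Ioo measurableSet_Ioc
      (aemeasurable_comp_mul_enorm_deriv hSm (hgd.continuousOn.mono hSV)
        (measurable_logDensity _ _))]
    refine le_trans ?_ (setLIntegral_mono' measurableSet_Ioo hcirc)
    rw [setLIntegral_const, Real.volume_Ioo, ← ENNReal.ofReal_mul hLpos.le]
    exact ENNReal.ofReal_le_ofReal (by linarith)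
  have hcs := sq_lintegral_mul_comp_mul_enorm_deriv_le isOpen_re_neg hSV hSm hgd
    (hp.comp_exp hneg) (ρ := fun _ => 1) aemeasurable_const (measurable_logDensity (p + 1) ‖F z₀‖)
  have hfin : ENNReal.ofReal (L / 4) ^ 2 ≤ ENNReal.ofReal (1 / 4 * (2 * Real.pi)) *
      (p * ENNReal.ofReal (2 * Real.pi * Real.log (‖F z₀‖ / (p + 1)))) := by
    refine (pow_le_pow_left₀ (zero_le) hInt 2).trans (hcs.trans ?_)
    gcongr
    · rw [one_pow, setLIntegral_one, hS, volume_reProdIm measurableSet_Ioo measurableSet_Ioc,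
        Real.volume_Ioo, Real.volume_Ioc, ← ENNReal.ofReal_mul (by norm_num)]
      exact ENNReal.ofReal_le_ofReal (by ring_nf; rfl)
    · exact lintegral_sq_logDensity_le hr₁ hlt.le
  rw [Real.log_div hM.ne' hr₁.ne', ← hL, ← ENNReal.ofReal_pow (by positivity),
    ← ENNReal.ofReal_natCast, ← ENNReal.ofReal_mul (by positivity),
    ← ENNReal.ofReal_mul (by positivity), ENNReal.ofReal_le_ofReal_iff (by positivity)] at hfin
  have hLle : L ≤ 16 * Real.pi ^ 2 * p := by
    refine le_of_mul_le_mul_left ?_ hLpos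
    nlinarith
  have : Real.log ‖F z₀‖ ≤ Real.log (p + 1) + 16 * Real.pi ^ 2 * p := by linarith
  rw [Real.log_le_iff_le_exp hM, Real.exp_add, Real.exp_log hr₁] at this
  exact this

theorem setLIntegral_Ioo_comp_neg (f : ℝ → ℝ≥0∞) (a b : ℝ) :
    ∫⁻ s in Ioo a b, f (-s) = ∫⁻ s in Ioo (-b) (-a), f s := by
  have h := (Measure.measurePreserving_neg (volume : Measure ℝ)).setLIntegral_comp_preimage_emb
    (MeasurableEquiv.neg ℝ).measurableEmbedding f (Ioo (-b) (-a))
  simpa using h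

theorem setLIntegral_Ioo_comp_const_add (f : ℝ → ℝ≥0∞) (x a b : ℝ) :
    ∫⁻ s in Ioo a b, f (x + s) = ∫⁻ s in Ioo (x + a) (x + b), f s := by
  have h := (measurePreserving_add_left (volume : Measure ℝ) x).setLIntegral_comp_preimage_emb
    (measurableEmbedding_addLeft x) f (Ioo (x + a) (x + b))
  simpa using h

theorem ofReal_le_add_four {y x₁ x₂ x₃ x₄ : ℝ} {E₁ E₂ E₃ E₄ : ℝ≥0∞}
    (h₁ : ENNReal.ofReal x₁ ≤ E₁) (h₂ : ENNReal.ofReal x₂ ≤ E₂) (h₃ : ENNReal.ofReal x₃ ≤ E₃)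
    (h₄ : ENNReal.ofReal x₄ ≤ E₄) (h : y ≤ x₁ + x₂ + x₃ + x₄) :
    ENNReal.ofReal y ≤ E₁ + E₂ + E₃ + E₄ := by
  refine (ENNReal.ofReal_le_ofReal h).trans ((ENNReal.ofReal_add_le).trans ?_)
  refine add_le_add ((ENNReal.ofReal_add_le).trans ?_) h₄
  exact add_le_add ((ENNReal.ofReal_add_le).trans (add_le_add h₁ h₂)) h₃

theorem isOpen_abs_im_lt (c : ℝ) : IsOpen {z : ℂ | |z.im| < c} :=
  isOpen_lt Complex.continuous_im.abs continuous_const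

/-- Around the boundary of a rectangle, a function that is small at the midpoint of the left side
and large somewhere inside has large total logarithmic variation. -/
theorem ofReal_two_mul_le_lintegral_rectangle {g : ℂ → ℂ} {c : ℝ}
    (hg : DifferentiableOn ℂ g {z | |z.im| < c}) {x s r₁ r₂ : ℝ} (hx : 0 ≤ x) (hs : 0 < s)
    (hsc : s < c) (h₁ : 0 < r₁) (h₂ : r₁ ≤ r₂) (hlow : ‖g ((-s : ℝ) + (0 : ℝ) * Complex.I)‖ ≤ r₁)
    (hhigh : r₂ ≤ ‖g x‖) :
    ENNReal.ofReal (2 * (Real.log r₂ - Real.log r₁)) ≤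
      (∫⁻ u in Ioc (-s) (x + s), logDensity r₁ r₂ (g (u + (-s : ℝ) * Complex.I)) *
        ‖deriv g (u + (-s : ℝ) * Complex.I)‖ₑ) +
      (∫⁻ u in Ioc (-s) (x + s), logDensity r₁ r₂ (g (u + s * Complex.I)) *
        ‖deriv g (u + s * Complex.I)‖ₑ) +
      (∫⁻ v in Ioc (-s) s, logDensity r₁ r₂ (g ((-s : ℝ) + v * Complex.I)) *
        ‖deriv g ((-s : ℝ) + v * Complex.I)‖ₑ) +
      ∫⁻ v in Ioc (-s) s, logDensity r₁ r₂ (g ((x + s : ℝ) + v * Complex.I)) *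
        ‖deriv g ((x + s : ℝ) + v * Complex.I)‖ₑ := by
  have hV := isOpen_abs_im_lt c
  have hxs : -s < x + s := by linarith
  have hss : -s < s := by linarith
  have hrect : closure (Ioo (-s) (x + s) ×ℂ Ioo (-s) s) = Icc (-s) (x + s) ×ℂ Icc (-s) s := by
    rw [Complex.closure_reProdIm, closure_Ioo hxs.ne, closure_Ioo hss.ne]
  obtain ⟨w, hw, hmax⟩ := Complex.exists_mem_frontier_isMaxOn_norm
    (f := g) (U := Ioo (-s) (x + s) ×ℂ Ioo (-s) s)
    ((Metric.isBounded_Ioo _ _).reProdIm (Metric.isBounded_Ioo _ _))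
    ⟨x, by simp [Complex.mem_reProdIm]; constructor <;> linarith⟩
    (DifferentiableOn.diffContOnCl (by
      rw [hrect]
      refine hg.mono fun z hz => ?_
      exact (abs_le.2 hz.2).trans_lt hsc))
  rw [Complex.frontier_reProdIm, closure_Ioo hxs.ne, closure_Ioo hss.ne, frontier_Ioo hxs,
    frontier_Ioo hss] at hw
  have hwr : r₂ ≤ ‖g w‖ := hhigh.trans (hmax (by
    rw [hrect, Complex.mem_reProdIm]; simp; constructor <;> linarith))
  rw [← Complex.re_add_im w] at hwr
  have hQ := clampLog_of_le_norm h₂ hwr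
  have hP := clampLog_of_norm_le (r₂ := r₂) hlow
  have hor : ∀ {v a b t₁ t₂ : ℝ}, |v| < c → a ≤ t₁ → t₁ ≤ t₂ → t₂ ≤ b → _ :=
    fun {v a b t₁ t₂} hv h1 h2 h3 => ofReal_three_abs_clampLog_horizontal_le hV hg (v := v) h1 h2 h3
      (fun u _ => by simpa using hv) h₁ h₂
  have hver : ∀ {u t₁ t₂ : ℝ}, -s ≤ t₁ → t₁ ≤ t₂ → t₂ ≤ s → _ :=
    fun {u t₁ t₂} h1 h2 h3 => ofReal_three_abs_clampLog_vertical_le hV hg (u := u) h1 h2 h3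
      (fun v hv => by simpa using (abs_le.2 hv).trans_lt hsc) h₁ h₂
  have hsabs : |s| < c := by rwa [abs_of_pos hs]
  have hsabs' : |-s| < c := by rwa [abs_neg]
  set cl := clampLog r₁ r₂
  have tri : ∀ a b : ℂ, cl a - cl b ≤ |cl a - cl b| ∧ cl b - cl a ≤ |cl a - cl b| :=
    fun a b => ⟨le_abs_self _, by rw [abs_sub_comm]; exact le_abs_self _⟩
  rcases hw with ⟨hre, him⟩ | ⟨hre, him⟩
  · rcases him with him | him
    · rw [him] at hQ
      refine ofReal_le_add_four (hor hsabs' hre.1 hre.2 le_rfl) (hor hsabs le_rfl hxs.le le_rfl)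
        (hver (by linarith : -s ≤ 0) hs.le le_rfl) (hver le_rfl hss.le le_rfl) ?_
      grind
    · rw [him] at hQ
      refine ofReal_le_add_four (hor hsabs' le_rfl hxs.le le_rfl) (hor hsabs hre.1 hre.2 le_rfl)
        (hver (by linarith : -s ≤ 0) hs.le le_rfl) (hver le_rfl hss.le le_rfl) ?_
      grind
  · rcases hre with hre | hre
    · rw [hre] at hQ
      rcases le_total 0 w.im with h0 | h0
      · refine ofReal_le_add_four (hor hsabs' le_rfl hxs.le le_rfl) (hor hsabs le_rfl hxs.le le_rfl)
          (hver (by linarith : -s ≤ 0) h0 him.2) (hver le_rfl hss.le le_rfl) ?_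
        grind
      · refine ofReal_le_add_four (hor hsabs' le_rfl hxs.le le_rfl) (hor hsabs le_rfl hxs.le le_rfl)
          (hver him.1 h0 hs.le) (hver le_rfl hss.le le_rfl) ?_
        grind
    · rw [hre] at hQ
      refine ofReal_le_add_four (hor hsabs' le_rfl hxs.le le_rfl) (hor hsabs le_rfl hxs.le le_rfl)
        (hver (by linarith : -s ≤ 0) hs.le le_rfl) (hver him.1 him.2 le_rfl) ?_
      grind

theorem norm_le_of_strip {p : ℕ} {g : ℂ → ℂ}
    (hg : DifferentiableOn ℂ g {z | |z.im| < Real.pi / 2})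
    (hp : PValentOn p g {z | |z.im| < Real.pi / 2}) {x r₁ : ℝ} (hx : 0 ≤ x) (h₁ : 0 < r₁)
    (hlow : ∀ s ∈ Ioo 0 (Real.pi / 2), ‖g ((-s : ℝ) + (0 : ℝ) * Complex.I)‖ ≤ r₁) :
    ‖g x‖ ≤ r₁ * Real.exp (2 * p * (x + 4 * Real.pi)) := by
  classical
  have hπ := Real.pi_pos
  rcases le_or_gt ‖g x‖ r₁ with h | hlt
  · exact h.trans (le_mul_of_one_le_right h₁.le (Real.one_le_exp (by positivity)))
  have hM : 0 < ‖g x‖ := h₁.trans hlt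
  set L := Real.log ‖g x‖ - Real.log r₁ with hL
  have hLpos : 0 < L := sub_pos.2 (Real.log_lt_log h₁ hlt)
  set V : Set ℂ := {z | |z.im| < Real.pi / 2} with hVdef
  have hV : IsOpen V := isOpen_abs_im_lt _
  have hG : Measurable (V.piecewise g fun _ => 0) :=
    ContinuousOn.measurable_piecewise hg.continuousOn continuousOn_const hV.measurableSet
  set k : ℂ → ℝ≥0∞ := fun z => logDensity r₁ ‖g x‖ (V.piecewise g (fun _ => 0) z) * ‖deriv g z‖ₑ
    with hk
  have hkm : Measurable k :=
    ((measurable_logDensity _ _).comp hG).mul (measurable_deriv g).enorm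
  have hkV : ∀ z ∈ V, logDensity r₁ ‖g x‖ (g z) * ‖deriv g z‖ₑ = k z := by
    intro z hz
    simp only [hk, Set.piecewise_eq_of_mem _ _ _ hz]
  set I := Ioo (-(Real.pi / 2)) (x + Real.pi / 2) with hI
  set J := Ioo (-(Real.pi / 2)) (Real.pi / 2) with hJ
  set H : ℝ → ℝ≥0∞ := fun v => ∫⁻ u in I, k (u + v * Complex.I) with hH
  set W : ℝ → ℝ≥0∞ := fun u => ∫⁻ v in J, k (u + v * Complex.I) with hW
  have hHm : Measurable H := by
    have : Measurable fun q : ℝ × ℝ => k (q.2 + q.1 * Complex.I) := by fun_prop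
    exact this.lintegral_prod_right'
  have hWm : Measurable W := by
    have : Measurable fun q : ℝ × ℝ => k (q.1 + q.2 * Complex.I) := by fun_prop
    exact this.lintegral_prod_right'
  have hpt : ∀ s ∈ Ioo 0 (Real.pi / 2),
      ENNReal.ofReal (2 * L) ≤ H (-s) + H s + W (-s) + W (x + s) := by
    intro s hs
    refine (ofReal_two_mul_le_lintegral_rectangle hg hx hs.1 hs.2 h₁ hlt.le (hlow s hs)
      le_rfl).trans ?_
    have hor : ∀ v : ℝ, |v| < Real.pi / 2 → ∫⁻ u in Ioc (-s) (x + s),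
        logDensity r₁ ‖g x‖ (g (u + v * Complex.I)) * ‖deriv g (u + v * Complex.I)‖ₑ ≤ H v := by
      intro v hv
      rw [hH, setLIntegral_congr_fun measurableSet_Ioc fun u _ => hkV _ (by simpa [hVdef] using hv)]
      exact lintegral_mono_set fun u hu => ⟨by linarith [hu.1, hs.2], by linarith [hu.2, hs.2]⟩
    have hver : ∀ u : ℝ, ∫⁻ v in Ioc (-s) s,
        logDensity r₁ ‖g x‖ (g (u + v * Complex.I)) * ‖deriv g (u + v * Complex.I)‖ₑ ≤ W u := by
      intro u
      have hsub : Ioc (-s) s ⊆ J :=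
        fun v hv => ⟨by linarith [hv.1, hs.2], by linarith [hv.2, hs.2]⟩
      rw [hW, setLIntegral_congr_fun measurableSet_Ioc fun v hv =>
        hkV _ (by simpa [hVdef] using abs_lt.2 (hsub hv))]
      exact lintegral_mono_set hsub
    have hsabs : |s| < Real.pi / 2 := by rw [abs_of_pos hs.1]; exact hs.2
    exact add_le_add (add_le_add (add_le_add (hor _ (by rwa [abs_neg])) (hor _ hsabs)) (hver _))
      (hver _)
  set S := I ×ℂ J with hS
  set T : Set ℂ := Ioo (-(Real.pi / 2)) 0 ×ℂ J ∪ Ioo x (x + Real.pi / 2) ×ℂ J with hT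
  have hSm : MeasurableSet S := measurableSet_reProdIm measurableSet_Ioo measurableSet_Ioo
  have hTlm : MeasurableSet (Ioo (-(Real.pi / 2)) 0 ×ℂ J) :=
    measurableSet_reProdIm measurableSet_Ioo measurableSet_Ioo
  have hTrm : MeasurableSet (Ioo x (x + Real.pi / 2) ×ℂ J) :=
    measurableSet_reProdIm measurableSet_Ioo measurableSet_Ioo
  have hTm : MeasurableSet T := hTlm.union hTrm
  have hTS : T ⊆ S := by
    rintro z (⟨h1, h2⟩ | ⟨h1, h2⟩)
    · exact ⟨⟨h1.1, by have := h1.2; linarith⟩, h2⟩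
    · exact ⟨⟨by have := h1.1; linarith, h1.2⟩, h2⟩
  have hdisj : Disjoint (Ioo (-(Real.pi / 2)) 0 ×ℂ J) (Ioo x (x + Real.pi / 2) ×ℂ J) := by
    rw [Set.disjoint_left]
    rintro z ⟨h1, -⟩ ⟨h2, -⟩
    have h3 := h1.2
    have h4 := h2.1
    linarith
  have hSV : S ⊆ V := fun z hz => abs_lt.2 hz.2
  have hInt : ENNReal.ofReal (Real.pi * L) ≤
      ∫⁻ z in S, (1 + T.indicator 1 z) * (logDensity r₁ ‖g x‖ (g z) * ‖deriv g z‖ₑ) := by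
    rw [setLIntegral_congr_fun (g := fun z => k z + T.indicator k z) hSm fun z hz => by
      simp only
      rw [hkV z (hSV hz), add_mul, one_mul]
      by_cases hzT : z ∈ T <;> simp [hzT]]
    rw [lintegral_add_left hkm, setLIntegral_indicator hTm, inter_eq_left.2 hTS, hT,
      lintegral_union hTrm hdisj, hS, lintegral_reProdIm_symm measurableSet_Ioo measurableSet_Ioo
        hkm.aemeasurable, lintegral_reProdIm measurableSet_Ioo measurableSet_Ioo hkm.aemeasurable,
      lintegral_reProdIm measurableSet_Ioo measurableSet_Ioo hkm.aemeasurable]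
    change _ ≤ (∫⁻ v in J, H v) + ((∫⁻ u in Ioo (-(Real.pi / 2)) 0, W u) +
      ∫⁻ u in Ioo x (x + Real.pi / 2), W u)
    have e1 : (∫⁻ s in Ioo 0 (Real.pi / 2), H (-s)) + ∫⁻ s in Ioo 0 (Real.pi / 2), H s ≤
        ∫⁻ v in J, H v := by
      rw [setLIntegral_Ioo_comp_neg, neg_zero, ← lintegral_union measurableSet_Ioo]
      · refine lintegral_mono_set ?_
        rintro v (hv | hv)
        · exact ⟨hv.1, by have := hv.2; linarith⟩
        · exact ⟨by have := hv.1; linarith, hv.2⟩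
      · rw [Set.disjoint_left]
        rintro v hv hv'
        exact lt_asymm hv.2 hv'.1
    have e2 := setLIntegral_Ioo_comp_neg W 0 (Real.pi / 2)
    have e3 := setLIntegral_Ioo_comp_const_add W x 0 (Real.pi / 2)
    rw [neg_zero] at e2
    rw [add_zero] at e3
    rw [← e2, ← e3]
    refine le_trans ?_ (add_le_add_left e1 _)
    rw [← lintegral_add_left (by fun_prop), ← lintegral_add_left (by fun_prop),
      ← lintegral_add_left (by fun_prop)]
    refine le_trans ?_ (setLIntegral_mono' (f := fun _ => ENNReal.ofReal (2 * L))
      measurableSet_Ioo fun s hs => ?_)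
    · rw [setLIntegral_const, Real.volume_Ioo, ← ENNReal.ofReal_mul (by positivity)]
      exact ENNReal.ofReal_le_ofReal (by linarith)
    · rw [← add_assoc]
      exact hpt s hs
  have hcs := sq_lintegral_mul_comp_mul_enorm_deriv_le hV hSV hSm hg (hp.mono hSV)
    (ρ := fun z => 1 + T.indicator 1 z)
    (measurable_const.add (measurable_one.indicator hTm)).aemeasurable
    (measurable_logDensity r₁ ‖g x‖)
  have hρ : ∫⁻ z in S, (1 + T.indicator 1 z : ℝ≥0∞) ^ 2 ≤
      ENNReal.ofReal (Real.pi * (x + 4 * Real.pi)) := by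
    have e : ∀ z, (1 + T.indicator 1 z : ℝ≥0∞) ^ 2 = 1 + T.indicator (fun _ => 3) z := by
      intro z
      by_cases hz : z ∈ T <;> simp [hz]
      norm_num
    simp_rw [e]
    rw [lintegral_add_left measurable_const, setLIntegral_one, setLIntegral_indicator hTm,
      inter_eq_left.2 hTS, setLIntegral_const, hT, measure_union hdisj hTrm, hS,
      volume_reProdIm measurableSet_Ioo measurableSet_Ioo,
      volume_reProdIm measurableSet_Ioo measurableSet_Ioo,
      volume_reProdIm measurableSet_Ioo measurableSet_Ioo, Real.volume_Ioo, Real.volume_Ioo,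
      Real.volume_Ioo, Real.volume_Ioo, show (3 : ℝ≥0∞) = ENNReal.ofReal 3 by simp,
      ← ENNReal.ofReal_mul (by linarith), ← ENNReal.ofReal_mul (by linarith),
      ← ENNReal.ofReal_mul (by linarith), ← ENNReal.ofReal_add (by nlinarith) (by nlinarith),
      ← ENNReal.ofReal_mul (by norm_num), ← ENNReal.ofReal_add (by nlinarith) (by nlinarith)]
    exact ENNReal.ofReal_le_ofReal (by nlinarith)
  have hfin : ENNReal.ofReal (Real.pi * L) ^ 2 ≤
      ENNReal.ofReal (Real.pi * (x + 4 * Real.pi)) *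
        (p * ENNReal.ofReal (2 * Real.pi * Real.log (‖g x‖ / r₁))) := by
    refine (pow_le_pow_left₀ zero_le hInt 2).trans (hcs.trans ?_)
    gcongr
    exact lintegral_sq_logDensity_le h₁ hlt.le
  rw [Real.log_div hM.ne' h₁.ne', ← hL, ← ENNReal.ofReal_pow (by positivity),
    ← ENNReal.ofReal_natCast, ← ENNReal.ofReal_mul (by positivity),
    ← ENNReal.ofReal_mul (by positivity), ENNReal.ofReal_le_ofReal_iff (by positivity)] at hfin
  have hLle : L ≤ 2 * p * (x + 4 * Real.pi) := by
    refine le_of_mul_le_mul_left ?_ (by positivity : 0 < Real.pi ^ 2 * L)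
    nlinarith
  have : Real.log ‖g x‖ ≤ Real.log r₁ + 2 * p * (x + 4 * Real.pi) := by linarith
  rw [Real.log_le_iff_le_exp hM, Real.exp_add, Real.exp_log h₁] at this
  exact this

theorem exp_re_pos_of_abs_im_lt {w : ℂ} (hw : |w.im| < Real.pi / 2) :
    0 < (Complex.exp w).re := by
  rw [Complex.exp_re]
  exact mul_pos (Real.exp_pos _) (Real.cos_pos_of_mem_Ioo (abs_lt.1 hw))

theorem norm_sub_one_lt_norm_add_one {e : ℂ} (he : 0 < e.re) : ‖e - 1‖ < ‖e + 1‖ := by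
  rw [← sq_lt_sq₀ (norm_nonneg _) (norm_nonneg _), ← Complex.normSq_eq_norm_sq,
    ← Complex.normSq_eq_norm_sq, Complex.normSq_apply, Complex.normSq_apply]
  simp
  nlinarith

theorem one_seventh_le_exp_neg {s : ℝ} (hs : s < Real.pi / 2) : 1 / 7 ≤ Real.exp (-s) := by
  have h1 : 1 - s / 5 ≤ Real.exp (-s / 5) := by
    have := Real.add_one_le_exp (-s / 5)
    linarith
  have h2 : 0.684 ≤ 1 - s / 5 := by
    have := Real.pi_lt_d2
    linarith
  have h3 : Real.exp (-s) = Real.exp (-s / 5) ^ 5 := by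
    rw [← Real.exp_nat_mul]
    congr 1
    push_cast
    ring
  rw [h3]
  calc (1 / 7 : ℝ) ≤ 0.684 ^ 5 := by norm_num
    _ ≤ _ := pow_le_pow_left₀ (by norm_num) (h2.trans h1) 5

theorem norm_mul_one_sub_norm_pow_le {p : ℕ} {a : ℕ → ℂ} {F : ℂ → ℂ}
    (hF : ∀ z ∈ Metric.ball (0 : ℂ) 1, HasSum (fun k : ℕ => a k * z ^ k) (F z))
    (hp : PValentOn p F (Metric.ball 0 1)) (ha0 : a 0 = 0)
    (ha : ∀ i, 1 ≤ i → i ≤ p → ‖a i‖ ≤ 1) {z : ℂ} (hz : ‖z‖ < 1) :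
    ‖F z‖ * (1 - ‖z‖) ^ (2 * p) ≤
      (p + 1) * Real.exp (16 * Real.pi ^ 2 * p) * Real.exp (8 * Real.pi * p) * 4 ^ p := by
  have hd := differentiableOn_of_hasSum hF
  obtain ⟨ζ, hζ, hzζ⟩ : ∃ ζ : ℂ, ‖ζ‖ = 1 ∧ z = ζ * ‖z‖ := by
    refine ⟨Complex.exp (z.arg * Complex.I), Complex.norm_exp_ofReal_mul_I _, ?_⟩
    rw [mul_comm, Complex.norm_mul_exp_arg_mul_I]
  have hζ0 : ζ ≠ 0 := norm_ne_zero_iff.1 (by rw [hζ]; exact one_ne_zero)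
  set r := ‖z‖ with hr
  have hr0 : 0 ≤ r := norm_nonneg z
  set V : Set ℂ := {z | |z.im| < Real.pi / 2} with hV
  set φ : ℂ → ℂ := fun w => ζ * ((Complex.exp w - 1) / (Complex.exp w + 1)) with hφ
  have hne : ∀ w ∈ V, Complex.exp w + 1 ≠ 0 := by
    intro w hw h0
    have h1 := norm_sub_one_lt_norm_add_one (exp_re_pos_of_abs_im_lt hw)
    rw [h0, norm_zero] at h1
    exact absurd h1 (norm_nonneg _).not_gt
  have hmaps : MapsTo φ V (Metric.ball 0 1) := by
    intro w hw
    have h1 := norm_sub_one_lt_norm_add_one (exp_re_pos_of_abs_im_lt hw)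
    rw [mem_ball_zero_iff, hφ, norm_mul, hζ, one_mul, norm_div, div_lt_one]
    · exact h1
    · exact norm_pos_iff.2 (hne w hw)
  have hinj : InjOn φ V := by
    intro w hw w' hw' h
    have h1 := mul_left_cancel₀ hζ0 h
    rw [div_eq_div_iff (hne w hw) (hne w' hw')] at h1
    have h2 : Complex.exp w = Complex.exp w' := by linear_combination h1 / 2
    have hπ := Real.pi_pos
    have h3 := abs_lt.1 (show |w.im| < Real.pi / 2 from hw)
    have h4 := abs_lt.1 (show |w'.im| < Real.pi / 2 from hw')
    exact Complex.exp_inj_of_neg_pi_lt_of_le_pi (by linarith) (by linarith) (by linarith)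
      (by linarith) h2
  have hφd : DifferentiableOn ℂ φ V :=
    (((Complex.differentiable_exp.sub_const 1).differentiableOn).div
      ((Complex.differentiable_exp.add_const 1).differentiableOn) hne).const_mul ζ
  have h1r : 0 < 1 - r := sub_pos.2 hz
  have hq : 1 ≤ (1 + r) / (1 - r) := by
    rw [one_le_div h1r]
    linarith
  have hq0 : 0 < (1 + r) / (1 - r) := by linarith
  have key := norm_le_of_strip (hd.comp hφd hmaps) (hp.comp_injOn hmaps hinj)
    (x := Real.log ((1 + r) / (1 - r)))
    (r₁ := (p + 1) * Real.exp (16 * Real.pi ^ 2 * p)) (Real.log_nonneg hq) (by positivity) ?_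
  · have e1 : φ (Real.log ((1 + r) / (1 - r)) : ℝ) = z := by
      have : (1 - r : ℂ) ≠ 0 := by exact_mod_cast h1r.ne'
      have h2 : (1 + r : ℂ) / (1 - r) + 1 ≠ 0 := by
        have : (1 + r) / (1 - r) + 1 ≠ 0 := by positivity
        exact_mod_cast this
      rw [hφ, hzζ]
      simp only
      rw [← Complex.ofReal_exp, Real.exp_log hq0]
      push_cast
      congr 1
      rw [div_eq_iff h2]
      field_simp
      ring
    rw [Function.comp_apply, e1] at key
    have e2 : Real.exp (2 * p * (Real.log ((1 + r) / (1 - r)) + 4 * Real.pi)) =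
        Real.exp (8 * Real.pi * p) * ((1 + r) / (1 - r)) ^ (2 * p) := by
      rw [← Real.exp_log (pow_pos hq0 (2 * p)), ← Real.exp_add, Real.log_pow]
      congr 1
      push_cast
      ring
    rw [e2] at key
    have h4 : (1 + r) ^ (2 * p) ≤ 4 ^ p := by
      rw [pow_mul]
      exact pow_le_pow_left₀ (by positivity) (by nlinarith) p
    calc ‖F z‖ * (1 - r) ^ (2 * p) ≤ (p + 1) * Real.exp (16 * Real.pi ^ 2 * p) *
          (Real.exp (8 * Real.pi * p) * ((1 + r) / (1 - r)) ^ (2 * p)) * (1 - r) ^ (2 * p) := by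
          gcongr
      _ = (p + 1) * Real.exp (16 * Real.pi ^ 2 * p) * Real.exp (8 * Real.pi * p) *
          (1 + r) ^ (2 * p) := by
          rw [div_pow]
          field_simp
      _ ≤ _ := by gcongr
  · intro s hs
    refine norm_le_of_norm_le_three_quarters hF hp ha0 ha ?_
    rw [hφ]
    simp only [Complex.ofReal_zero, zero_mul, add_zero]
    rw [norm_mul, hζ, one_mul, ← Complex.ofReal_exp]
    have h7 := one_seventh_le_exp_neg hs.2
    have h8 : Real.exp (-s) < 1 := by
      rw [Real.exp_lt_one_iff]
      linarith [hs.1]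
    have e3 : ((Real.exp (-s) : ℝ) - 1 : ℂ) / ((Real.exp (-s) : ℝ) + 1) =
        ((Real.exp (-s) - 1) / (Real.exp (-s) + 1) : ℝ) := by
      push_cast
      ring
    rw [e3, Complex.norm_real, Real.norm_eq_abs, abs_div, abs_of_neg (by linarith),
      abs_of_pos (by positivity), div_le_iff₀ (by positivity)]
    linarith

theorem enorm_le_add_lintegral_horizontal {g : ℂ → ℂ} {V : Set ℂ} (hV : IsOpen V)
    (hg : DifferentiableOn ℂ g V) {a b v : ℝ} (hab : a ≤ b)
    (hsub : ∀ u ∈ Icc a b, (u + v * Complex.I : ℂ) ∈ V) :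
    ‖g (b + v * Complex.I)‖ₑ ≤ ‖g (a + v * Complex.I)‖ₑ +
      ∫⁻ u in Ioc a b, ‖deriv g (u + v * Complex.I)‖ₑ := by
  have hc : ContinuousOn (fun u : ℝ => deriv g (u + v * Complex.I)) (Icc a b) :=
    (hg.deriv hV).continuousOn.comp (by fun_prop) hsub
  have h := intervalIntegral.integral_eq_sub_of_hasDerivAt (a := a) (b := b)
    (f := fun t : ℝ => g (t + v * Complex.I)) (f' := fun t : ℝ => deriv g (t + v * Complex.I))
    (fun u hu => by
      rw [uIcc_of_le hab] at hu
      exact hasDerivAt_comp_ofReal_add ((hg _ (hsub u hu)).differentiableAt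
        (hV.mem_nhds (hsub u hu)))) (hc.intervalIntegrable_of_Icc hab)
  rw [intervalIntegral.integral_of_le hab] at h
  calc ‖g (b + v * Complex.I)‖ₑ
      = ‖g (a + v * Complex.I) + (g (b + v * Complex.I) - g (a + v * Complex.I))‖ₑ := by
        rw [add_sub_cancel]
    _ ≤ _ := (enorm_add_le _ _).trans (by
        gcongr
        rw [← h]
        exact enorm_integral_le_lintegral_enorm _)

theorem lintegral_enorm_deriv_ne_top {g : ℂ → ℂ}
    (hg : DifferentiableOn ℂ g {z | z.re < 0}) {a b : ℝ} (hb : b < 0) :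
    ∫⁻ z in Ioc a b ×ℂ Ioc (-Real.pi) Real.pi, ‖deriv g z‖ₑ ≠ ⊤ := by
  have hcpt : IsCompact (Icc a b ×ℂ Icc (-Real.pi) Real.pi) := isCompact_Icc.reProdIm isCompact_Icc
  have hsub : Icc a b ×ℂ Icc (-Real.pi) Real.pi ⊆ {z : ℂ | z.re < 0} :=
    reProdIm_subset_re_neg fun u hu => hu.2.trans_lt hb
  have h1 := (((hg.deriv isOpen_re_neg).continuousOn.mono hsub).integrableOn_compact
    (μ := volume) hcpt).2
  refine ne_top_of_le_ne_top h1.ne (lintegral_mono_set fun z hz => ?_)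
  exact ⟨Ioc_subset_Icc_self hz.1, Ioc_subset_Icc_self hz.2⟩

theorem sq_lintegral_enorm_deriv_le {p : ℕ} {g : ℂ → ℂ}
    (hg : DifferentiableOn ℂ g {z | z.re < 0}) {a b C T : ℝ} (ha : -1 ≤ a)
    (hb : b < 0) (hp : PValentOn p g (Ioc a b ×ℂ Ioc (-Real.pi) Real.pi))
    (hC : ∀ v : ℝ, ‖g ((-1 : ℝ) + v * Complex.I)‖ ≤ C)
    (hT : ∀ z : ℂ, z.re ≤ b → ‖g z‖ ≤ T) :
    (∫⁻ z in Ioc a b ×ℂ Ioc (-Real.pi) Real.pi, ‖deriv g z‖ₑ) ^ 2 ≤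
      (ENNReal.ofReal (b - a) * (ENNReal.ofReal (2 * Real.pi * (1 + C)) +
        ∫⁻ z in Ioc (-1) b ×ℂ Ioc (-Real.pi) Real.pi, ‖deriv g z‖ₑ)) *
      (p * ENNReal.ofReal (2 * Real.pi * T)) := by
  have hC0 : 0 ≤ C := (norm_nonneg _).trans (hC 0)
  set S := Ioc a b ×ℂ Ioc (-Real.pi) Real.pi with hS
  have hSm : MeasurableSet S := measurableSet_reProdIm measurableSet_Ioc measurableSet_Ioc
  have hSV : S ⊆ {z : ℂ | z.re < 0} := reProdIm_subset_re_neg fun u hu => hu.2.trans_lt hb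
  have hgm : AEMeasurable g (volume.restrict S) :=
    (hg.continuousOn.mono hSV).aemeasurable hSm
  set ρ : ℂ → ℝ≥0∞ := fun z => ENNReal.ofReal √(1 + ‖g z‖) with hρ
  set ψ : ℂ → ℝ≥0∞ :=
    {w : ℂ | ‖w‖ ≤ T}.indicator fun w => ENNReal.ofReal √(1 + ‖w‖)⁻¹ with hψ
  have hψm : Measurable ψ :=
    Measurable.indicator (by fun_prop) (measurableSet_le measurable_norm measurable_const)
  have hρm : AEMeasurable ρ (volume.restrict S) := by
    have : Measurable fun w : ℂ => ENNReal.ofReal √(1 + ‖w‖) := by fun_prop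
    exact this.comp_aemeasurable hgm
  have hcs := sq_lintegral_mul_comp_mul_enorm_deriv_le isOpen_re_neg hSV hSm hg hp hρm hψm
  have e1 : ∫⁻ z in S, ρ z * (ψ (g z) * ‖deriv g z‖ₑ) = ∫⁻ z in S, ‖deriv g z‖ₑ := by
    refine setLIntegral_congr_fun hSm fun z hz => ?_
    have hm : g z ∈ {w : ℂ | ‖w‖ ≤ T} := hT z hz.1.2
    have hpos : 0 < 1 + ‖g z‖ := by positivity
    simp only [hρ, hψ, indicator_of_mem hm]
    rw [← mul_assoc, ← ENNReal.ofReal_mul (Real.sqrt_nonneg _), Real.sqrt_inv,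
      mul_inv_cancel₀ (Real.sqrt_pos.2 hpos).ne', ENNReal.ofReal_one, one_mul]
  have e2 : ∫⁻ w, ψ w ^ 2 ≤ ENNReal.ofReal (2 * Real.pi * T) := by
    refine le_of_eq_of_le (lintegral_congr fun w => ?_)
      (lintegral_indicator_inv_one_add_norm_le T)
    by_cases hw : w ∈ {w : ℂ | ‖w‖ ≤ T}
    · rw [hψ, indicator_of_mem hw, indicator_of_mem hw, ← ENNReal.ofReal_pow (Real.sqrt_nonneg _),
        Real.sq_sqrt (by positivity)]
    · rw [hψ, indicator_of_notMem hw, indicator_of_notMem hw, zero_pow two_ne_zero]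
  have hS1 : Ioc (-1) b ×ℂ Ioc (-Real.pi) Real.pi ⊆ {z : ℂ | z.re < 0} :=
    reProdIm_subset_re_neg fun u hu => hu.2.trans_lt hb
  have e3 : ∫⁻ z in S, ρ z ^ 2 ≤ ENNReal.ofReal (b - a) * (ENNReal.ofReal (2 * Real.pi * (1 + C)) +
      ∫⁻ z in Ioc (-1) b ×ℂ Ioc (-Real.pi) Real.pi, ‖deriv g z‖ₑ) := by
    rw [hS, lintegral_reProdIm measurableSet_Ioc measurableSet_Ioc (hρm.pow_const 2),
      lintegral_reProdIm_symm measurableSet_Ioc measurableSet_Ioc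
        (measurable_deriv g).enorm.aemeasurable]
    refine (setLIntegral_mono' (g := fun _ => ENNReal.ofReal (2 * Real.pi * (1 + C)) +
      ∫⁻ v in Ioc (-Real.pi) Real.pi, ∫⁻ u in Ioc (-1) b, ‖deriv g (u + v * Complex.I)‖ₑ)
      measurableSet_Ioc fun u hu => ?_).trans ?_
    · have e4 : ∫⁻ v in Ioc (-Real.pi) Real.pi, ENNReal.ofReal (1 + C) =
          ENNReal.ofReal (2 * Real.pi * (1 + C)) := by
        rw [setLIntegral_const, Real.volume_Ioc, ← ENNReal.ofReal_mul (by positivity)]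
        congr 1
        ring
      rw [← e4, ← lintegral_add_left measurable_const]
      refine lintegral_mono fun v => ?_
      simp only [hρ]
      rw [← ENNReal.ofReal_pow (Real.sqrt_nonneg _), Real.sq_sqrt (by positivity),
        ENNReal.ofReal_add zero_le_one (norm_nonneg _), ENNReal.ofReal_add zero_le_one hC0,
        ofReal_norm, add_assoc]
      gcongr
      refine (enorm_le_add_lintegral_horizontal isOpen_re_neg hg (a := -1)
        (by linarith [hu.1]) fun t ht => ?_).trans ?_
      · have : t < 0 := by linarith [ht.2, hu.2]
        simpa using this
      · gcongr
        · rw [← ofReal_norm]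
          exact ENNReal.ofReal_le_ofReal (hC v)
        · exact hu.2
    · rw [setLIntegral_const, Real.volume_Ioc, mul_comm]
  rw [e1] at hcs
  refine hcs.trans ?_
  gcongr

theorem le_of_sq_le_mul_add {x s t E : ℝ} (ht : 0 ≤ t) (hE : E ≤ s) (hs : 0 < s)
    (hst : 3 * t ≤ s) (h : x ^ 2 ≤ t * (E + (s + x))) : x ≤ s := by
  by_contra! hlt
  nlinarith [mul_nonneg ht (sub_nonneg.2 hlt.le), mul_pos hs (sub_pos.2 hlt)]

/-- Growth of the integral of `‖g'‖` over `-1 < re z ≤ -2⁻ᵏ`. -/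
theorem lintegral_enorm_deriv_le {p : ℕ} (hp1 : 1 ≤ p) {g : ℂ → ℂ}
    (hg : DifferentiableOn ℂ g {z | z.re < 0})
    (hp : PValentOn p g (Iio 0 ×ℂ Ioc (-Real.pi) Real.pi)) {C : ℝ}
    (hC : ∀ k : ℕ, ∀ z : ℂ, z.re ≤ -(1 / 2) ^ (k + 1) → ‖g z‖ ≤ C * (4 ^ p) ^ k) (k : ℕ) :
    ∫⁻ z in Ioc (-1) (-(1 / 2 : ℝ) ^ k) ×ℂ Ioc (-Real.pi) Real.pi, ‖deriv g z‖ₑ ≤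
      ENNReal.ofReal ((2 * Real.pi * (1 + C) + 3 * (2 * Real.pi * p * C)) *
        (2 ^ (2 * p - 1)) ^ k) := by
  have hπ := Real.pi_pos
  have hC0 : 0 ≤ C := by
    have := hC 0 (-1) (by norm_num)
    simp only [pow_zero, mul_one] at this
    exact (norm_nonneg _).trans this
  set E := 2 * Real.pi * (1 + C) with hE
  set D := 2 * Real.pi * p * C with hD
  have hE0 : 0 < E := by positivity
  have hD0 : 0 ≤ D := by positivity
  set q : ℝ := 2 ^ (2 * p - 1) with hq
  have hq2 : 2 ≤ q := by
    calc (2 : ℝ) = 2 ^ 1 := (pow_one _).symm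
      _ ≤ q := pow_le_pow_right₀ one_le_two (by omega)
  have hq4 : (4 : ℝ) ^ p = 2 * q := by
    rw [hq, ← pow_succ', show 2 * p - 1 + 1 = 2 * p by omega, pow_mul]
    norm_num
  induction k with
  | zero => simp [Complex.reProdIm]
  | succ k ih =>
    set a : ℝ := -(1 / 2) ^ k with ha
    set b : ℝ := -(1 / 2) ^ (k + 1) with hb
    have hpk : (0 : ℝ) < (1 / 2) ^ k := by positivity
    have hba : b - a = (1 / 2) ^ (k + 1) := by rw [ha, hb, pow_succ]; ring
    have ha1 : -1 ≤ a := by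
      rw [ha, neg_le_neg_iff]
      exact pow_le_one₀ (by norm_num) (by norm_num)
    have hb0 : b < 0 := by rw [hb, neg_lt_zero]; positivity
    have hab : a ≤ b := by rw [ha, hb, pow_succ]; linarith
    set X := ∫⁻ z in Ioc a b ×ℂ Ioc (-Real.pi) Real.pi, ‖deriv g z‖ₑ with hX
    have hXt : X ≠ ⊤ := lintegral_enorm_deriv_ne_top hg hb0
    have hsplit : ∫⁻ z in Ioc (-1) b ×ℂ Ioc (-Real.pi) Real.pi, ‖deriv g z‖ₑ ≤
        ENNReal.ofReal ((E + 3 * D) * q ^ k + X.toReal) := by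
      have : Ioc (-1) b ×ℂ Ioc (-Real.pi) Real.pi =
          Ioc (-1) a ×ℂ Ioc (-Real.pi) Real.pi ∪ Ioc a b ×ℂ Ioc (-Real.pi) Real.pi := by
        rw [← Ioc_union_Ioc_eq_Ioc ha1 hab]
        ext z
        simp only [Complex.mem_reProdIm, mem_union, or_and_right]
      rw [this, ENNReal.ofReal_add (by positivity) ENNReal.toReal_nonneg,
        ENNReal.ofReal_toReal hXt]
      exact (lintegral_union_le _ _ _).trans (by gcongr)
    have hsq := sq_lintegral_enorm_deriv_le (C := C) (T := C * (4 ^ p) ^ k) hg ha1 hb0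
      (hp.mono fun z hz => ⟨hz.1.2.trans_lt hb0, hz.2⟩)
      (fun v => by simpa using hC 0 ((-1 : ℝ) + v * Complex.I) (by simp; norm_num)) (hC k)
    have hsq' : X ^ 2 ≤ (ENNReal.ofReal (b - a) * (ENNReal.ofReal E +
        ENNReal.ofReal ((E + 3 * D) * q ^ k + X.toReal))) *
        (p * ENNReal.ofReal (2 * Real.pi * (C * (4 ^ p) ^ k))) := hsq.trans (by gcongr)
    rw [← ENNReal.ofReal_toReal hXt, ← ENNReal.ofReal_pow ENNReal.toReal_nonneg,
      ENNReal.toReal_ofReal ENNReal.toReal_nonneg,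
      ← ENNReal.ofReal_add hE0.le (by positivity), ← ENNReal.ofReal_natCast,
      ← ENNReal.ofReal_mul (by linarith), ← ENNReal.ofReal_mul (by positivity),
      ← ENNReal.ofReal_mul (by rw [hba]; positivity),
      ENNReal.ofReal_le_ofReal_iff (by rw [hba]; positivity), hba, hq4] at hsq'
    have hpow : (1 / 2 : ℝ) ^ (k + 1) * (2 * q) ^ k = q ^ k / 2 := by
      rw [mul_pow, pow_succ, one_div, inv_pow]
      field_simp
    have hqk : 1 ≤ q ^ k := one_le_pow₀ (by linarith)
    have hx : X.toReal ≤ (E + 3 * D) * q ^ k := by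
      refine le_of_sq_le_mul_add (t := D * q ^ k) (E := E) (by positivity) (by nlinarith)
        (by positivity) (by nlinarith) (hsq'.trans ?_)
      have hY : 0 ≤ E + ((E + 3 * D) * q ^ k + X.toReal) := by positivity
      calc _ = D * ((1 / 2 : ℝ) ^ (k + 1) * (2 * q) ^ k) *
            (E + ((E + 3 * D) * q ^ k + X.toReal)) := by rw [hD]; ring
        _ ≤ _ := by
          rw [hpow]
          gcongr
          linarith
    refine hsplit.trans (ENNReal.ofReal_le_ofReal ?_)
    rw [pow_succ]
    have : 0 ≤ (E + 3 * D) * q ^ k := by positivity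
    nlinarith

theorem eq_iteratedDeriv_div_factorial {a : ℕ → ℂ} {F : ℂ → ℂ}
    (hF : ∀ z ∈ Metric.ball (0 : ℂ) 1, HasSum (fun k : ℕ => a k * z ^ k) (F z)) (n : ℕ) :
    a n = iteratedDeriv n F 0 / n.factorial := by
  have h := (hasFPowerSeriesOnBall_ofScalars_of_hasSum hF).hasFPowerSeriesAt
  have h1 := h.eq_formalMultilinearSeries h.analyticAt.hasFPowerSeriesAt
  have h2 := congrArg (fun q => FormalMultilinearSeries.coeff q n) h1
  simpa [FormalMultilinearSeries.coeff_ofScalars] using h2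

/-- Cauchy's estimate for the Taylor coefficients in terms of the `L¹` mean of the derivative. -/
theorem ofReal_mul_norm_coeff_le {a : ℕ → ℂ} {F : ℂ → ℂ}
    (hF : ∀ z ∈ Metric.ball (0 : ℂ) 1, HasSum (fun k : ℕ => a k * z ^ k) (F z)) (n : ℕ)
    {u : ℝ} (hu : u < 0) :
    ENNReal.ofReal (2 * Real.pi * (n * ‖a n‖ * Real.exp (n * u))) ≤
      ∫⁻ v in Ioc (-Real.pi) Real.pi, ‖deriv (F ∘ Complex.exp) (u + v * Complex.I)‖ₑ := by
  rcases n with _ | m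
  · simp
  have hπ := Real.pi_pos
  have hd := differentiableOn_of_hasSum hF
  have hdd := hd.deriv Metric.isOpen_ball
  have hexp : Real.exp u < 1 := by simpa using hu
  set r : ℝ≥0 := ⟨Real.exp u, (Real.exp_pos u).le⟩ with hr
  have hr0 : 0 < r := Real.exp_pos u
  have hrc : (r : ℝ) = Real.exp u := rfl
  have hps := ((hdd.mono (Metric.closedBall_subset_ball (by rw [hrc]; exact hexp))
    ).hasFPowerSeriesOnBall hr0).hasFPowerSeriesAt
  have h1 := hps.eq_formalMultilinearSeries hps.analyticAt.hasFPowerSeriesAt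
  have hcoef : (cauchyPowerSeries (deriv F) 0 r).coeff m = (m + 1 : ℕ) * a (m + 1) := by
    rw [h1, FormalMultilinearSeries.coeff_ofScalars, eq_iteratedDeriv_div_factorial hF,
      iteratedDeriv_succ', Nat.factorial_succ]
    have h2 : (m.factorial : ℂ) ≠ 0 := by exact_mod_cast m.factorial_ne_zero
    have h3 : ((m + 1 : ℕ) : ℂ) ≠ 0 := by exact_mod_cast m.succ_ne_zero
    push_cast at h3 ⊢
    field_simp
  have hnorm := norm_cauchyPowerSeries_le (deriv F) 0 r m
  rw [FormalMultilinearSeries.norm_apply_eq_norm_coef, hcoef, norm_mul, Complex.norm_natCast,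
    abs_of_pos (by exact_mod_cast hr0), hrc] at hnorm
  have hgd : ∀ v : ℝ, ‖deriv (F ∘ Complex.exp) (u + v * Complex.I)‖ =
      ‖deriv F (circleMap 0 (Real.exp u) v)‖ * Real.exp u := by
    intro v
    have hmem : Complex.exp (u + v * Complex.I) ∈ Metric.ball (0 : ℂ) 1 := by
      simpa [Complex.norm_exp] using hu
    rw [deriv_comp _ ((hd _ hmem).differentiableAt (Metric.isOpen_ball.mem_nhds hmem))
      Complex.differentiableAt_exp, norm_mul, Complex.deriv_exp, circleMap, zero_add,
      Complex.ofReal_exp, ← Complex.exp_add, Complex.norm_exp (u + _)]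
    simp
  have hcirc : ∀ v : ℝ, circleMap 0 (Real.exp u) v ∈ Metric.ball (0 : ℂ) 1 := fun v => by
    simpa [abs_of_pos (Real.exp_pos u)] using hexp
  have hcont : Continuous fun v : ℝ => deriv F (circleMap 0 (Real.exp u) v) :=
    hdd.continuousOn.comp_continuous (continuous_circleMap _ _) hcirc
  have hper : ∫ θ in (0 : ℝ)..2 * Real.pi, ‖deriv F (circleMap 0 (Real.exp u) θ)‖ =
      ∫ θ in (-Real.pi)..Real.pi, ‖deriv F (circleMap 0 (Real.exp u) θ)‖ := by
    have hp : Function.Periodic (fun θ => ‖deriv F (circleMap 0 (Real.exp u) θ)‖)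
        (2 * Real.pi) := fun θ => by
      simp only [periodic_circleMap 0 (Real.exp u) θ]
    have := hp.intervalIntegral_add_eq 0 (-Real.pi)
    rwa [zero_add, show -Real.pi + 2 * Real.pi = Real.pi by ring] at this
  rw [hper, intervalIntegral.integral_of_le (by linarith)] at hnorm
  have hInt : Integrable (fun v : ℝ => deriv F (circleMap 0 (Real.exp u) v) * Real.exp u)
      (volume.restrict (Ioc (-Real.pi) Real.pi)) :=
    ((hcont.mul continuous_const).integrableOn_Icc (a := -Real.pi) (b := Real.pi)).mono_set
      Ioc_subset_Icc_self
  have hrhs : ∫⁻ v in Ioc (-Real.pi) Real.pi,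
      ‖deriv (F ∘ Complex.exp) (u + v * Complex.I)‖ₑ = ENNReal.ofReal
        ((∫ v in Ioc (-Real.pi) Real.pi, ‖deriv F (circleMap 0 (Real.exp u) v)‖) *
          Real.exp u) := by
    rw [← integral_mul_const]
    have e : ∀ v : ℝ, ‖deriv F (circleMap 0 (Real.exp u) v)‖ * Real.exp u =
        ‖deriv F (circleMap 0 (Real.exp u) v) * Real.exp u‖ := fun v => by
      rw [norm_mul, Complex.norm_real, Real.norm_of_nonneg (Real.exp_pos u).le]
    simp_rw [e]
    rw [ofReal_integral_norm_eq_lintegral_enorm hInt]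
    refine lintegral_congr fun v => ?_
    rw [← ofReal_norm, ← ofReal_norm, hgd, e]
  rw [hrhs]
  refine ENNReal.ofReal_le_ofReal ?_
  have hexpn : Real.exp ((m + 1 : ℕ) * u) = Real.exp u ^ m * Real.exp u := by
    rw [Real.exp_nat_mul, pow_succ]
  have hE := Real.exp_pos u
  calc 2 * Real.pi * ((m + 1 : ℕ) * ‖a (m + 1)‖ * Real.exp ((m + 1 : ℕ) * u))
      ≤ 2 * Real.pi * (((2 * Real.pi)⁻¹ * ∫ v in Ioc (-Real.pi) Real.pi,
        ‖deriv F (circleMap 0 (Real.exp u) v)‖) * (Real.exp u)⁻¹ ^ m *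
          Real.exp ((m + 1 : ℕ) * u)) := by gcongr
    _ = _ := by
      rw [hexpn, inv_pow]
      field_simp

theorem half_le_one_sub_exp_neg {t : ℝ} (h0 : 0 ≤ t) (h1 : t ≤ 1) :
    t / 2 ≤ 1 - Real.exp (-t) := by
  have h2 := Real.add_one_le_exp t
  have h3 : Real.exp (-t) * Real.exp t = 1 := by rw [← Real.exp_add]; simp
  have h4 := Real.exp_pos (-t)
  nlinarith

theorem exists_norm_coeff_le (p : ℕ) (hp1 : 1 ≤ p) :
    ∃ A : ℝ, 0 < A ∧ ∀ (a : ℕ → ℂ) (F : ℂ → ℂ),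
      (∀ z ∈ Metric.ball (0 : ℂ) 1, HasSum (fun k : ℕ => a k * z ^ k) (F z)) →
      PValentOn p F (Metric.ball 0 1) → a 0 = 0 → (∀ i, 1 ≤ i → i ≤ p → ‖a i‖ ≤ 1) →
      ∀ n : ℕ, 1 ≤ n → ‖a n‖ ≤ A * (n : ℝ) ^ (2 * p - 1) := by
  have hπ := Real.pi_pos
  set K : ℝ :=
    (p + 1) * Real.exp (16 * Real.pi ^ 2 * p) * Real.exp (8 * Real.pi * p) * 4 ^ p with hK
  have hK0 : 0 < K := by positivity
  set C : ℝ := K * 16 ^ p with hC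
  have hC0 : 0 < C := by positivity
  set B : ℝ := 2 * Real.pi * (1 + C) + 3 * (2 * Real.pi * p * C) with hB
  have hB0 : 0 < B := by positivity
  refine ⟨B * 2 ^ (2 * p - 1) * Real.exp 2, by positivity, fun a F hF hp ha0 ha n hn => ?_⟩
  have hd := differentiableOn_of_hasSum hF
  have hgrow : ∀ k : ℕ, ∀ z : ℂ, z.re ≤ -(1 / 2) ^ (k + 1) →
      ‖(F ∘ Complex.exp) z‖ ≤ C * (4 ^ p) ^ k := by
    intro k z hz
    have ht0 : (0 : ℝ) < (1 / 2) ^ (k + 1) := by positivity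
    have ht1 : (1 / 2 : ℝ) ^ (k + 1) ≤ 1 := pow_le_one₀ (by norm_num) (by norm_num)
    have h1 : (1 / 2) ^ (k + 1) / 2 ≤ 1 - ‖Complex.exp z‖ := by
      rw [Complex.norm_exp]
      have := Real.exp_le_exp.2 hz
      linarith [half_le_one_sub_exp_neg ht0.le ht1]
    have h2 := norm_mul_one_sub_norm_pow_le hF hp ha0 ha (z := Complex.exp z) (by linarith)
    have h3 : ((1 / 2 : ℝ) ^ (k + 1) / 2) ^ (2 * p) ≤ (1 - ‖Complex.exp z‖) ^ (2 * p) :=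
      pow_le_pow_left₀ (by positivity) h1 _
    have h4 : ((1 / 2 : ℝ) ^ (k + 1) / 2) ^ (2 * p) * (16 ^ p * (4 ^ p) ^ k) = 1 := by
      have e1 : (16 : ℝ) ^ p = 4 ^ (2 * p) := by rw [pow_mul]; norm_num
      have e2 : ((4 : ℝ) ^ p) ^ k = (2 ^ k) ^ (2 * p) := by
        rw [← pow_mul, ← pow_mul, show (4 : ℝ) = 2 ^ 2 by norm_num, ← pow_mul]
        congr 1
        ring
      rw [e1, e2, ← mul_pow, ← mul_pow]
      convert one_pow (2 * p) using 2
      rw [pow_succ, one_div, inv_pow]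
      field_simp
      norm_num
    have h5 : ‖F (Complex.exp z)‖ * ((1 / 2 : ℝ) ^ (k + 1) / 2) ^ (2 * p) ≤ K :=
      (mul_le_mul_of_nonneg_left h3 (norm_nonneg _)).trans h2
    calc ‖F (Complex.exp z)‖ = ‖F (Complex.exp z)‖ * ((1 / 2 : ℝ) ^ (k + 1) / 2) ^ (2 * p) *
          (16 ^ p * (4 ^ p) ^ k) := by rw [mul_assoc, h4, mul_one]
      _ ≤ K * (16 ^ p * (4 ^ p) ^ k) := by gcongr
      _ = _ := by rw [hC]; ring
  set k := Nat.log 2 n with hk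
  have hk1 : (2 : ℝ) ^ k ≤ n := by exact_mod_cast Nat.pow_log_le_self 2 (by omega)
  have hk2 : (n : ℝ) < 2 ^ (k + 1) := by exact_mod_cast Nat.lt_pow_succ_log_self one_lt_two n
  have harea := lintegral_enorm_deriv_le hp1 (differentiableOn_comp_exp hd)
    (hp.comp_exp le_rfl) hgrow (k + 1)
  have hlow : ENNReal.ofReal (2 * Real.pi * (n * ‖a n‖ * Real.exp (-2)) * (1 / 2) ^ (k + 1)) ≤
      ∫⁻ z in Ioc (-1) (-(1 / 2 : ℝ) ^ (k + 1)) ×ℂ Ioc (-Real.pi) Real.pi,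
        ‖deriv (F ∘ Complex.exp) z‖ₑ := by
    have hpk : (1 / 2 : ℝ) ^ k ≤ 1 := pow_le_one₀ (by norm_num) (by norm_num)
    have hsub : Ioc (-(1 / 2 : ℝ) ^ k) (-(1 / 2) ^ (k + 1)) ⊆ Ioc (-1) (-(1 / 2 : ℝ) ^ (k + 1)) :=
      Ioc_subset_Ioc_left (by linarith)
    rw [lintegral_reProdIm measurableSet_Ioc measurableSet_Ioc
      (measurable_deriv _).enorm.aemeasurable]
    refine le_trans ?_ (lintegral_mono_set hsub)
    refine le_trans ?_ (setLIntegral_mono'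
      (f := fun _ => ENNReal.ofReal (2 * Real.pi * (n * ‖a n‖ * Real.exp (-2))))
      measurableSet_Ioc fun u hu => ?_)
    · rw [setLIntegral_const, Real.volume_Ioc, ← ENNReal.ofReal_mul (by positivity)]
      refine ENNReal.ofReal_le_ofReal (le_of_eq ?_)
      rw [pow_succ]
      ring
    · have hu0 : u < 0 := hu.2.trans_lt (by rw [neg_lt_zero]; positivity)
      refine le_trans (ENNReal.ofReal_le_ofReal ?_) (ofReal_mul_norm_coeff_le hF n hu0)
      gcongr
      have h6 : (2 : ℝ) ^ (k + 1) * (1 / 2) ^ k = 2 := by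
        rw [pow_succ, one_div, inv_pow]
        field_simp
      have h7 : (0 : ℝ) < (1 / 2) ^ k := by positivity
      have h8 : (n : ℝ) * (1 / 2) ^ k ≤ 2 :=
        (mul_le_mul_of_nonneg_right hk2.le h7.le).trans h6.le
      have h9 : (0 : ℝ) ≤ n := n.cast_nonneg
      nlinarith [hu.1]
  have hfin := hlow.trans harea
  rw [ENNReal.ofReal_le_ofReal_iff (by positivity)] at hfin
  have hqk : ((2 : ℝ) ^ (2 * p - 1)) ^ (k + 1) ≤ 2 ^ (2 * p - 1) * (n : ℝ) ^ (2 * p - 1) := by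
    rw [pow_succ', ← pow_mul, mul_comm (2 * p - 1) k, pow_mul]
    gcongr
  have hn2 : 1 ≤ 2 * (n * (1 / 2 : ℝ) ^ (k + 1)) := by
    have h6 : (2 : ℝ) ^ k * (1 / 2) ^ (k + 1) = 1 / 2 := by
      rw [pow_succ, one_div, inv_pow]
      field_simp
    have h7 : (2 : ℝ) ^ k * (1 / 2) ^ (k + 1) ≤ n * (1 / 2) ^ (k + 1) := by gcongr
    linarith
  have hee : Real.exp 2 * Real.exp (-2) = 1 := by rw [← Real.exp_add]; simp
  have hπ1 : 1 ≤ Real.pi := by linarith [Real.pi_gt_three]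
  calc ‖a n‖ = Real.exp 2 * (‖a n‖ * Real.exp (-2)) := by
        linear_combination -‖a n‖ * hee
    _ ≤ Real.exp 2 * (‖a n‖ * Real.exp (-2) *
        (Real.pi * (2 * (n * (1 / 2 : ℝ) ^ (k + 1))))) := by
        refine mul_le_mul_of_nonneg_left (le_mul_of_one_le_right (by positivity)
          (one_le_mul_of_one_le_of_one_le hπ1 hn2)) (Real.exp_pos 2).le
    _ = Real.exp 2 * (2 * Real.pi * (n * ‖a n‖ * Real.exp (-2)) * (1 / 2) ^ (k + 1)) := by ring
    _ ≤ Real.exp 2 * (B * (2 ^ (2 * p - 1) * (n : ℝ) ^ (2 * p - 1))) := by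
        refine mul_le_mul_of_nonneg_left (hfin.trans ?_) (Real.exp_pos 2).le
        exact mul_le_mul_of_nonneg_left hqk hB0.le
    _ = _ := by ring

theorem pValentOn_ball_of_ncard_le {p : ℕ} {f : ℂ → ℂ} {R : ℝ}
    (h : ∀ c : ℂ, {z : ℂ | ‖z‖ < R ∧ f z = c}.Finite ∧
      {z : ℂ | ‖z‖ < R ∧ f z = c}.ncard ≤ p) : PValentOn p f (Metric.ball 0 R) := by
  intro T hT hf
  rcases T.eq_empty_or_nonempty with rfl | ⟨w, hw⟩
  · simp
  rw [← Set.ncard_coe_finset]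
  refine (Set.ncard_le_ncard (fun z hz => ?_) (h (f w)).1).trans (h (f w)).2
  exact ⟨by simpa using hT z hz, hf z hz w hw⟩

/-- **Biernacki's theorem.** There is a function `A : ℕ → ℝ`, positive everywhere, such that
every function `f(z) = ∑ aₖ zᵏ`, analytic and `p`-valent in the disk `D_R`, satisfies the
`(p, R, A(p)·k^(2p-1))`-Taylor domination property:
`|aₖ|·Rᵏ ≤ A(p)·k^(2p-1)·max_{1≤i≤p}|aᵢ|·Rⁱ` for all `k ≥ p+1`. -/
theorem biernacki_taylor_domination :
    ∃ A : ℕ → ℝ, (∀ p : ℕ, 0 < A p) ∧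
      ∀ (p : ℕ) (hp : 1 ≤ p) (R : ℝ), 0 < R →
      ∀ (a : ℕ → ℂ) (f : ℂ → ℂ),
        (∀ z ∈ Metric.ball (0 : ℂ) R, HasSum (fun k : ℕ => a k * z ^ k) (f z)) →
        (∀ c : ℂ, {z : ℂ | ‖z‖ < R ∧ f z = c}.Finite ∧
          {z : ℂ | ‖z‖ < R ∧ f z = c}.ncard ≤ p) →
        ∀ k : ℕ, p + 1 ≤ k →
          ‖a k‖ * R ^ k ≤ A p * (k : ℝ) ^ (2 * p - 1) *
            (Finset.Icc 1 p).sup' (Finset.nonempty_Icc.mpr hp)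
              (fun i => ‖a i‖ * R ^ i) := by
  have hex : ∀ p : ℕ, ∃ A : ℝ, 0 < A ∧ (1 ≤ p → ∀ (a : ℕ → ℂ) (F : ℂ → ℂ),
      (∀ z ∈ Metric.ball (0 : ℂ) 1, HasSum (fun k : ℕ => a k * z ^ k) (F z)) →
      PValentOn p F (Metric.ball 0 1) → a 0 = 0 → (∀ i, 1 ≤ i → i ≤ p → ‖a i‖ ≤ 1) →
      ∀ n : ℕ, 1 ≤ n → ‖a n‖ ≤ A * (n : ℝ) ^ (2 * p - 1)) := by
    intro p
    by_cases hp : 1 ≤ p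
    · obtain ⟨A, hA, h⟩ := exists_norm_coeff_le p hp
      exact ⟨A, hA, fun _ => h⟩
    · exact ⟨1, one_pos, fun h => absurd h hp⟩
  choose A hA hcoef using hex
  refine ⟨A, hA, fun p hp R hR a f hf hval k hk => ?_⟩
  set M := (Finset.Icc 1 p).sup' (Finset.nonempty_Icc.mpr hp) (fun i => ‖a i‖ * R ^ i) with hM
  have hle : ∀ i, 1 ≤ i → i ≤ p → ‖a i‖ * R ^ i ≤ M := fun i h1 h2 =>
    Finset.le_sup' (fun i => ‖a i‖ * R ^ i) (Finset.mem_Icc.2 ⟨h1, h2⟩)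
  have hM0 : 0 ≤ M := le_trans (by positivity) (hle 1 le_rfl hp)
  have hAk : 0 < A p * (k : ℝ) ^ (2 * p - 1) := by
    have : (0 : ℝ) < k := by exact_mod_cast (by omega : 0 < k)
    have := hA p
    positivity
  have key : ∀ μ, M < μ → ‖a k‖ * R ^ k ≤ A p * (k : ℝ) ^ (2 * p - 1) * μ := by
    intro μ hμ
    have hμ0 : 0 < μ := hM0.trans_lt hμ
    have hμc : (μ : ℂ) ≠ 0 := by exact_mod_cast hμ0.ne'
    have hball : MapsTo (fun z : ℂ => (R : ℂ) * z) (Metric.ball 0 1) (Metric.ball 0 R) := by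
      intro z hz
      have hz' : ‖z‖ < 1 := by simpa using hz
      simpa [abs_of_pos hR] using mul_lt_of_lt_one_right hR hz'
    have hnorm : ∀ i, 1 ≤ i →
        ‖(if i = 0 then 0 else a i * (R : ℂ) ^ i / μ)‖ = ‖a i‖ * R ^ i / μ := by
      intro i hi
      rw [if_neg (by omega), norm_div, norm_mul, norm_pow, Complex.norm_real, Complex.norm_real,
        Real.norm_of_nonneg hR.le, Real.norm_of_nonneg hμ0.le]
    have h := hcoef p hp (fun i => if i = 0 then 0 else a i * (R : ℂ) ^ i / μ)
      (fun z => (f (R * z) - a 0) / μ) ?_ ?_ (if_pos rfl) ?_ k (by omega)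
    · rw [hnorm k (by omega), div_le_iff₀ hμ0] at h
      exact h
    · intro z hz
      have h1 := ((hf _ (hball hz)).update 0 0).div_const (μ : ℂ)
      rw [show (f (R * z) - a 0) / μ = (0 - a 0 * ((R : ℂ) * z) ^ 0 + f (R * z)) / μ by
        rw [pow_zero]; ring]
      refine (congrArg (HasSum · _) (funext fun i => ?_)).mpr h1
      rcases eq_or_ne i 0 with rfl | hi
      · simp
      · simp only [Function.update_of_ne hi, if_neg hi]
        ring
    · have h1 := ((pValentOn_ball_of_ncard_le hval).comp_injOn hball
        (mul_right_injective₀ (by exact_mod_cast hR.ne')).injOn)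
      intro T hT hg
      refine h1 T hT fun z hz w hw => ?_
      exact sub_left_injective ((div_left_inj' hμc).1 (hg z hz w hw))
    · intro i h1 h2
      rw [hnorm i h1, div_le_one hμ0]
      exact (hle i h1 h2).trans hμ.le
  rw [← div_le_iff₀' hAk]
  refine le_of_forall_gt_imp_ge_of_dense fun μ hμ => ?_
  rw [div_le_iff₀' hAk]
  exact key μ hμ
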